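/- Let g be in normal form of order 2n+2, fix n ≥ 1, and assume a_{i,1} = 0 for 2 ≤ i ≤ n (no condition when n = 1), a_{n+1,1} ≠ 0, and a_{2,0} ≠ 0 (the singular point is not an inflection point). Let φ : (−ε,ε) → ℝ be any C^∞ function with φ(0) = 0, φ^{(j)}(0) = 0 for 1 ≤ j ≤ n, and Σ(t, φ(t)) = 0 for all |t| < ε (a branch of the parabolic set), and set L(t) = g(t, φ(t)). Then L'(0) × L''(0) = (0, −a_{2,0}, b₂) ≠ 0, so the torsion τ of L is defined near 0; let ν = σ·(0, −a_{2,0}, b₂)/√(a_{2,0}² + b₂²) for a sign σ ∈ {1,−1} (i.e., ν = ±b(0)). Then: (i) the height function h_ν has an A₂ singularity at (0,0) if and only if τ(0) ≠ 0; and (ii) h_ν has an A₃ singularity at (0,0) if and only if τ(0) = 0 and τ'(0) ≠ 0. -/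

import Mathlib

open Real Set

noncomputable section

/-- Partial derivative in the first variable. -/
def pdu {F : Type*} [NormedAddCommGroup F] [NormedSpace ℝ F] (f : ℝ → ℝ → F) : ℝ → ℝ → F :=
  fun u w => deriv (fun t => f t w) u

/-- Partial derivative in the second variable. -/
def pdw {F : Type*} [NormedAddCommGroup F] [NormedSpace ℝ F] (f : ℝ → ℝ → F) : ℝ → ℝ → F :=
  fun u w => deriv (fun t => f u t) w

/-- Iterated partial derivative `∂_u^i ∂_w^j f`. -/
def pd {F : Type*} [NormedAddCommGroup F] [NormedSpace ℝ F] (i j : ℕ) (f : ℝ → ℝ → F) :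
    ℝ → ℝ → F :=
  pdu^[i] (pdw^[j] f)

/-- The Euclidean inner product on `ℝ³ = ℝ × ℝ × ℝ`. -/
def dot3 (x y : ℝ × ℝ × ℝ) : ℝ := x.1 * y.1 + x.2.1 * y.2.1 + x.2.2 * y.2.2

/-- The cross product on `ℝ³ = ℝ × ℝ × ℝ`. -/
def cross3 (x y : ℝ × ℝ × ℝ) : ℝ × ℝ × ℝ :=
  (x.2.1 * y.2.2 - x.2.2 * y.2.1, x.2.2 * y.1 - x.1 * y.2.2, x.1 * y.2.1 - x.2.1 * y.1)

/-- The Euclidean norm on `ℝ³ = ℝ × ℝ × ℝ`. -/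
def norm3 (x : ℝ × ℝ × ℝ) : ℝ := Real.sqrt (dot3 x x)

/-- The surface parameterization `g(u,w) = (u, p(u,w), q(u,w))`. -/
def gmap (p q : ℝ → ℝ → ℝ) : ℝ → ℝ → ℝ × ℝ × ℝ := fun u w => (u, p u w, q u w)

/-- The height function on the surface parameterized by `g = (u, p, q)` along `v`. -/
def hgt (p q : ℝ → ℝ → ℝ) (v : ℝ × ℝ × ℝ) : ℝ → ℝ → ℝ :=
  fun u w => dot3 (gmap p q u w) v

/-- `g = (u, p(u,w), q(u,w))` is in normal form of order `N`. -/
def NormalFormN (N : ℕ) (p q : ℝ → ℝ → ℝ) (b : ℕ → ℝ) (a : ℕ → ℕ → ℝ) : Prop :=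
  ContDiff ℝ (⊤ : ℕ∞) (fun x : ℝ × ℝ => p x.1 x.2) ∧
  ContDiff ℝ (⊤ : ℕ∞) (fun x : ℝ × ℝ => q x.1 x.2) ∧
  p 0 0 = 0 ∧ q 0 0 = 0 ∧
  pd 1 0 p 0 0 = 0 ∧ pd 0 1 p 0 0 = 0 ∧ pd 1 0 q 0 0 = 0 ∧ pd 0 1 q 0 0 = 0 ∧
  pd 0 2 p 0 0 = 1 ∧
  (∀ i, 2 ≤ i → i ≤ N → pd i 0 p 0 0 = b i) ∧
  (∀ i j, 2 ≤ i + j → i + j ≤ N → 1 ≤ j → ¬(i = 0 ∧ j = 2) → pd i j p 0 0 = 0) ∧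
  (∀ i j, 2 ≤ i + j → i + j ≤ N → pd i j q 0 0 = a i j) ∧
  a 1 1 = 0 ∧ a 0 2 = 0

/-- `h` has an `A_k` singularity at the origin: up to a `C^∞` change of coordinates fixing
the origin, `h` equals `h(0,0) ± x² ± y^(k+1)`. -/
def HasAkSingAt (h : ℝ → ℝ → ℝ) (k : ℕ) : Prop :=
  ∃ (U V : Set (ℝ × ℝ)) (φ ψ : ℝ × ℝ → ℝ × ℝ) (ε₁ ε₂ : ℝ),
    IsOpen U ∧ IsOpen V ∧ ((0, 0) : ℝ × ℝ) ∈ U ∧ ((0, 0) : ℝ × ℝ) ∈ V ∧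
    ContDiffOn ℝ (⊤ : ℕ∞) φ U ∧ ContDiffOn ℝ (⊤ : ℕ∞) ψ V ∧
    Set.MapsTo φ U V ∧ Set.MapsTo ψ V U ∧
    (∀ x ∈ U, ψ (φ x) = x) ∧ (∀ y ∈ V, φ (ψ y) = y) ∧
    φ (0, 0) = (0, 0) ∧ (ε₁ = 1 ∨ ε₁ = -1) ∧ (ε₂ = 1 ∨ ε₂ = -1) ∧
    ∀ x ∈ U, h (φ x).1 (φ x).2 = h 0 0 + ε₁ * x.1 ^ 2 + ε₂ * x.2 ^ (k + 1)

/-- The parabolic-set function `Σ = ⟨g_uu, g_u × g_w⟩⟨g_ww, g_u × g_w⟩ − ⟨g_uw, g_u × g_w⟩²`. -/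
def SigmaFun (p q : ℝ → ℝ → ℝ) : ℝ → ℝ → ℝ := fun u w =>
  dot3 (pd 2 0 (gmap p q) u w) (cross3 (pd 1 0 (gmap p q) u w) (pd 0 1 (gmap p q) u w)) *
      dot3 (pd 0 2 (gmap p q) u w) (cross3 (pd 1 0 (gmap p q) u w) (pd 0 1 (gmap p q) u w)) -
    dot3 (pd 1 1 (gmap p q) u w) (cross3 (pd 1 0 (gmap p q) u w) (pd 0 1 (gmap p q) u w)) ^ 2

/-- The torsion of a space curve `L`. -/
def tor (L : ℝ → ℝ × ℝ × ℝ) : ℝ → ℝ := fun t =>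
  dot3 (cross3 (deriv L t) (deriv (deriv L) t)) (deriv (deriv (deriv L)) t) /
    norm3 (cross3 (deriv L t) (deriv (deriv L) t)) ^ 2

/-- The unit binormal vector of a space curve `L` at `t = 0`. -/
def binormal0 (L : ℝ → ℝ × ℝ × ℝ) : ℝ × ℝ × ℝ :=
  (norm3 (cross3 (deriv L 0) (deriv (deriv L) 0)))⁻¹ • cross3 (deriv L 0) (deriv (deriv L) 0)

/-- `f` is a parabolic Monge form with `∂_w² f(0,0) = k₂ ≠ 0`. -/
def MongeForm (f : ℝ → ℝ → ℝ) (k₂ : ℝ) : Prop :=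
  ContDiff ℝ (⊤ : ℕ∞) (fun x : ℝ × ℝ => f x.1 x.2) ∧ f 0 0 = 0 ∧
  pd 1 0 f 0 0 = 0 ∧ pd 0 1 f 0 0 = 0 ∧
  pd 2 0 f 0 0 = 0 ∧ pd 1 1 f 0 0 = 0 ∧ pd 0 2 f 0 0 = k₂ ∧ k₂ ≠ 0

/-- The parabolic-set function `P = f_uu f_ww − f_uw²` of a Monge form. -/
def Pfun (f : ℝ → ℝ → ℝ) : ℝ → ℝ → ℝ := fun u w =>
  pd 2 0 f u w * pd 0 2 f u w - pd 1 1 f u w ^ 2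

/-- A smooth function of two real variables. -/
def Smooth₂ (f : ℝ → ℝ → ℝ) : Prop := ContDiff ℝ (⊤ : ℕ∞) (fun x : ℝ × ℝ => f x.1 x.2)

namespace Smooth₂

variable {f : ℝ → ℝ → ℝ}

lemma hasFDerivAt (hf : Smooth₂ f) (x : ℝ × ℝ) :
    HasFDerivAt (fun x : ℝ × ℝ => f x.1 x.2) (fderiv ℝ (fun x : ℝ × ℝ => f x.1 x.2) x) x :=
  (ContDiff.differentiable hf (by simp) x).hasFDerivAt

lemma comp (hf : Smooth₂ f) {E : Type*} [NormedAddCommGroup E] [NormedSpace ℝ E] {α β : E → ℝ}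
    (hα : ContDiff ℝ (⊤ : ℕ∞) α) (hβ : ContDiff ℝ (⊤ : ℕ∞) β) :
    ContDiff ℝ (⊤ : ℕ∞) (fun t => f (α t) (β t)) :=
  ContDiff.comp (g := fun x : ℝ × ℝ => f x.1 x.2) hf (hα.prodMk hβ)

lemma continuous (hf : Smooth₂ f) : Continuous (fun x : ℝ × ℝ => f x.1 x.2) :=
  ContDiff.continuous hf

lemma hasDerivAt_comp_fderiv (hf : Smooth₂ f) {α β : ℝ → ℝ} {a b t : ℝ} (hα : HasDerivAt α a t)
    (hβ : HasDerivAt β b t) : HasDerivAt (fun t => f (α t) (β t))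
      (fderiv ℝ (fun x : ℝ × ℝ => f x.1 x.2) (α t, β t) (a, b)) t :=
  HasFDerivAt.comp_hasDerivAt (f := fun t => (α t, β t)) t (hf.hasFDerivAt (α t, β t))
    (hα.prodMk hβ)

lemma pdu_eq (hf : Smooth₂ f) (u w : ℝ) :
    pdu f u w = fderiv ℝ (fun x : ℝ × ℝ => f x.1 x.2) (u, w) (1, 0) :=
  (hf.hasDerivAt_comp_fderiv (hasDerivAt_id u) (hasDerivAt_const u w)).deriv

lemma pdw_eq (hf : Smooth₂ f) (u w : ℝ) :
    pdw f u w = fderiv ℝ (fun x : ℝ × ℝ => f x.1 x.2) (u, w) (0, 1) :=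
  (hf.hasDerivAt_comp_fderiv (hasDerivAt_const w u) (hasDerivAt_id w)).deriv

lemma contDiff_fderiv_apply (hf : Smooth₂ f) (v : ℝ × ℝ) :
    ContDiff ℝ (⊤ : ℕ∞) (fun x : ℝ × ℝ => fderiv ℝ (fun x : ℝ × ℝ => f x.1 x.2) x v) :=
  (ContDiff.fderiv_right hf (by simp)).clm_apply contDiff_const

lemma pdu (hf : Smooth₂ f) : Smooth₂ (pdu f) := by
  simpa [Smooth₂, hf.pdu_eq] using hf.contDiff_fderiv_apply (1, 0)

lemma pdw (hf : Smooth₂ f) : Smooth₂ (pdw f) := by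
  simpa [Smooth₂, hf.pdw_eq] using hf.contDiff_fderiv_apply (0, 1)

lemma pdw_iterate (hf : Smooth₂ f) (j : ℕ) : Smooth₂ (_root_.pdw^[j] f) := by
  induction j with
  | zero => exact hf
  | succ j ih => rw [Function.iterate_succ_apply']; exact ih.pdw

lemma pd (hf : Smooth₂ f) (i j : ℕ) : Smooth₂ (pd i j f) := by
  induction i with
  | zero => exact hf.pdw_iterate j
  | succ i ih => unfold _root_.pd at *; rw [Function.iterate_succ_apply']; exact ih.pdu

lemma hasDerivAt_comp (hf : Smooth₂ f) {α β : ℝ → ℝ} {a b t : ℝ} (hα : HasDerivAt α a t)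
    (hβ : HasDerivAt β b t) : HasDerivAt (fun t => f (α t) (β t))
      (_root_.pdu f (α t) (β t) * a + _root_.pdw f (α t) (β t) * b) t := by
  convert hf.hasDerivAt_comp_fderiv hα hβ using 1
  have : ((a, b) : ℝ × ℝ) = a • (1, 0) + b • (0, 1) := by simp
  rw [this, map_add, map_smul, map_smul, hf.pdu_eq, hf.pdw_eq, smul_eq_mul, smul_eq_mul]
  ring

lemma pdw_pdu (hf : Smooth₂ f) : _root_.pdw (_root_.pdu f) = _root_.pdu (_root_.pdw f) := by
  funext u w
  have hd : DifferentiableAt ℝ (fderiv ℝ (fun x : ℝ × ℝ => f x.1 x.2)) (u, w) :=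
    (ContDiff.fderiv_right (m := 1) hf (WithTop.coe_le_coe.2 le_top)).differentiable (by simp) _
  have key : ∀ v, fderiv ℝ (fun x : ℝ × ℝ => fderiv ℝ (fun x : ℝ × ℝ => f x.1 x.2) x v) (u, w) =
      (fderiv ℝ (fderiv ℝ (fun x : ℝ × ℝ => f x.1 x.2)) (u, w)).flip v := fun v => by
    rw [fderiv_clm_apply hd (by fun_prop)]
    simp
  have hs := (ContDiff.contDiffAt hf (x := (u, w))).isSymmSndFDerivAt
    (by simp only [minSmoothness_of_isRCLikeNormedField]; exact WithTop.coe_le_coe.2 le_top)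
  rw [hf.pdu.pdw_eq, hf.pdw.pdu_eq]
  simp only [hf.pdw_eq, hf.pdu_eq, Prod.mk.eta, key]
  exact hs _ _

lemma pdw_pd (hf : Smooth₂ f) (i j : ℕ) : _root_.pdw (_root_.pd i j f) = _root_.pd i (j + 1) f := by
  induction i with
  | zero => simp [_root_.pd, ← Function.iterate_succ_apply' _root_.pdw]
  | succ i ih =>
    have h : ∀ k, _root_.pd (i + 1) k f = _root_.pdu (_root_.pd i k f) := fun k =>
      Function.iterate_succ_apply' ..
    rw [h, h, (hf.pd i j).pdw_pdu, ih]

lemma pdu_pd (i j : ℕ) : _root_.pdu (_root_.pd i j f) = _root_.pd (i + 1) j f :=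
  (Function.iterate_succ_apply' ..).symm

lemma hasDerivAt_pd_comp (hf : Smooth₂ f) (i j : ℕ) {α β : ℝ → ℝ} {a b t : ℝ}
    (hα : HasDerivAt α a t) (hβ : HasDerivAt β b t) :
    HasDerivAt (fun t => _root_.pd i j f (α t) (β t))
      (_root_.pd (i + 1) j f (α t) (β t) * a + _root_.pd i (j + 1) f (α t) (β t) * b) t := by
  simpa only [hf.pdw_pd, pdu_pd] using (hf.pd i j).hasDerivAt_comp hα hβ

lemma pd_smooth_comp (hf : Smooth₂ f) (i j : ℕ) {α β : ℝ → ℝ}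
    (hα : ContDiff ℝ (⊤ : ℕ∞) α) (hβ : ContDiff ℝ (⊤ : ℕ∞) β) :
    ContDiff ℝ (⊤ : ℕ∞) (fun t => _root_.pd i j f (α t) (β t)) :=
  (hf.pd i j).comp hα hβ

end Smooth₂

lemma hasDerivAt_iterate_deriv {α : ℝ → ℝ} (hα : ContDiff ℝ (⊤ : ℕ∞) α) (k : ℕ) (t : ℝ) :
    HasDerivAt (deriv^[k] α) (deriv^[k + 1] α t) t := by
  rw [Function.iterate_succ_apply']
  exact ((hα.iterate_deriv k).differentiable (by simp) t).hasDerivAt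

section Jets

variable {f : ℝ → ℝ → ℝ} {α β : ℝ → ℝ}

lemma deriv_comp_curve (hf : Smooth₂ f) (hα : ContDiff ℝ (⊤ : ℕ∞) α)
    (hβ : ContDiff ℝ (⊤ : ℕ∞) β) :
    deriv (fun t => f (α t) (β t)) = fun t => pd 1 0 f (α t) (β t) * deriv^[1] α t +
      pd 0 1 f (α t) (β t) * deriv^[1] β t :=
  funext fun t => (hf.hasDerivAt_pd_comp 0 0 (hasDerivAt_iterate_deriv hα 0 t)
    (hasDerivAt_iterate_deriv hβ 0 t)).deriv

lemma deriv_deriv_comp_curve (hf : Smooth₂ f) (hα : ContDiff ℝ (⊤ : ℕ∞) α)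
    (hβ : ContDiff ℝ (⊤ : ℕ∞) β) :
    deriv^[2] (fun t => f (α t) (β t)) = fun t =>
      pd 2 0 f (α t) (β t) * deriv^[1] α t ^ 2 +
      2 * pd 1 1 f (α t) (β t) * deriv^[1] α t * deriv^[1] β t +
      pd 0 2 f (α t) (β t) * deriv^[1] β t ^ 2 +
      pd 1 0 f (α t) (β t) * deriv^[2] α t + pd 0 1 f (α t) (β t) * deriv^[2] β t := by
  funext t
  rw [Function.iterate_succ_apply', Function.iterate_one, deriv_comp_curve hf hα hβ]
  have hp := fun i j => hf.hasDerivAt_pd_comp i j (hasDerivAt_iterate_deriv hα 0 t)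
    (hasDerivAt_iterate_deriv hβ 0 t)
  have ha := fun k => hasDerivAt_iterate_deriv hα k t
  have hb := fun k => hasDerivAt_iterate_deriv hβ k t
  refine HasDerivAt.deriv (HasDerivAt.congr_deriv (
    ((hp 1 0).mul (ha 1)).add ((hp 0 1).mul (hb 1))) ?_)
  simp only [Function.iterate_zero, id_eq, zero_add, Nat.reduceAdd, Function.iterate_one]
  ring

lemma deriv_three_comp_curve (hf : Smooth₂ f) (hα : ContDiff ℝ (⊤ : ℕ∞) α)
    (hβ : ContDiff ℝ (⊤ : ℕ∞) β) :
    deriv^[3] (fun t => f (α t) (β t)) = fun t =>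
      pd 3 0 f (α t) (β t) * deriv^[1] α t ^ 3 +
      3 * pd 2 1 f (α t) (β t) * deriv^[1] α t ^ 2 * deriv^[1] β t +
      3 * pd 1 2 f (α t) (β t) * deriv^[1] α t * deriv^[1] β t ^ 2 +
      pd 0 3 f (α t) (β t) * deriv^[1] β t ^ 3 +
      3 * pd 2 0 f (α t) (β t) * deriv^[1] α t * deriv^[2] α t +
      3 * pd 1 1 f (α t) (β t) * (deriv^[2] α t * deriv^[1] β t + deriv^[1] α t * deriv^[2] β t) +
      3 * pd 0 2 f (α t) (β t) * deriv^[1] β t * deriv^[2] β t +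
      pd 1 0 f (α t) (β t) * deriv^[3] α t + pd 0 1 f (α t) (β t) * deriv^[3] β t := by
  funext t
  rw [Function.iterate_succ_apply', deriv_deriv_comp_curve hf hα hβ]
  have hp := fun i j => hf.hasDerivAt_pd_comp i j (hasDerivAt_iterate_deriv hα 0 t)
    (hasDerivAt_iterate_deriv hβ 0 t)
  have ha := fun k => hasDerivAt_iterate_deriv hα k t
  have hb := fun k => hasDerivAt_iterate_deriv hβ k t
  refine HasDerivAt.deriv (HasDerivAt.congr_deriv (
    (((((hp 2 0).mul ((ha 1).pow 2)).add ((((hp 1 1).const_mul 2).mul (ha 1)).mul (hb 1))).add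
    ((hp 0 2).mul ((hb 1).pow 2))).add ((hp 1 0).mul (ha 2))).add ((hp 0 1).mul (hb 2))) ?_)
  simp only [Function.iterate_zero, id_eq, zero_add, Nat.reduceAdd, Pi.pow_apply, Pi.mul_apply]
  push_cast
  ring

/-- The fourth derivative of `f` along a curve through the origin whose velocity is horizontal,
at a critical point of `f` with vanishing mixed second derivative. -/
lemma deriv_four_comp_curve (hf : Smooth₂ f) (hα : ContDiff ℝ (⊤ : ℕ∞) α)
    (hβ : ContDiff ℝ (⊤ : ℕ∞) β) (hα0 : α 0 = 0) (hβ0 : β 0 = 0) (hβ1 : deriv^[1] β 0 = 0)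
    (h10 : pd 1 0 f 0 0 = 0) (h01 : pd 0 1 f 0 0 = 0) (h11 : pd 1 1 f 0 0 = 0) :
    deriv^[4] (fun t => f (α t) (β t)) 0 =
      pd 4 0 f 0 0 * deriv^[1] α 0 ^ 4 + 6 * pd 2 1 f 0 0 * deriv^[1] α 0 ^ 2 * deriv^[2] β 0 +
      3 * pd 0 2 f 0 0 * deriv^[2] β 0 ^ 2 +
      6 * pd 3 0 f 0 0 * deriv^[1] α 0 ^ 2 * deriv^[2] α 0 +
      pd 2 0 f 0 0 * (3 * deriv^[2] α 0 ^ 2 + 4 * deriv^[1] α 0 * deriv^[3] α 0) := by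
  rw [Function.iterate_succ_apply', deriv_three_comp_curve hf hα hβ]
  have hp := fun i j => hf.hasDerivAt_pd_comp i j (hasDerivAt_iterate_deriv hα 0 0)
    (hasDerivAt_iterate_deriv hβ 0 0)
  have ha := fun k => hasDerivAt_iterate_deriv hα k 0
  have hb := fun k => hasDerivAt_iterate_deriv hβ k 0
  refine HasDerivAt.deriv (HasDerivAt.congr_deriv (
    (((((((((hp 3 0).mul ((ha 1).pow 3)).add
    ((((hp 2 1).const_mul 3).mul ((ha 1).pow 2)).mul (hb 1))).add
    ((((hp 1 2).const_mul 3).mul (ha 1)).mul ((hb 1).pow 2))).add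
    ((hp 0 3).mul ((hb 1).pow 3))).add
    ((((hp 2 0).const_mul 3).mul (ha 1)).mul (ha 2))).add
    (((hp 1 1).const_mul 3).mul (((ha 2).mul (hb 1)).add ((ha 1).mul (hb 2))))).add
    ((((hp 0 2).const_mul 3).mul (hb 1)).mul (hb 2))).add
    ((hp 1 0).mul (ha 3))).add ((hp 0 1).mul (hb 3))) ?_)
  simp only [Function.iterate_zero, id_eq, zero_add, Nat.reduceAdd, Pi.pow_apply, Pi.mul_apply,
    Pi.add_apply, hα0, hβ0, hβ1, h10, h01, h11]
  push_cast
  ring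

end Jets

open scoped Topology

section Tools

/-- A function smooth near a point has the same germ there as a globally smooth function. -/
lemma exists_contDiff_eventuallyEq {E F : Type*} [NormedAddCommGroup E] [NormedSpace ℝ E]
    [FiniteDimensional ℝ E] [NormedAddCommGroup F] [NormedSpace ℝ F] {f : E → F} {S : Set E}
    {x : E} (hS : IsOpen S) (hx : x ∈ S) (hf : ContDiffOn ℝ (⊤ : ℕ∞) f S) :
    ∃ g : E → F, ContDiff ℝ (⊤ : ℕ∞) g ∧ g =ᶠ[𝓝 x] f := by
  obtain ⟨d, hd, hdS⟩ := Euclidean.nhds_basis_closedBall.mem_iff.1 (hS.mem_nhds hx)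
  let c : ContDiffBump (toEuclidean x) := ⟨d / 2, d, half_pos hd, half_lt_self hd⟩
  let χ : E → ℝ := c ∘ toEuclidean
  have hχ : ContDiff ℝ (⊤ : ℕ∞) χ := c.contDiff.comp (toEuclidean (E := E)).contDiff
  have hsupp : tsupport χ ⊆ S := by
    refine Subset.trans (closure_minimal ?_ Euclidean.isClosed_closedBall) hdS
    intro y hy
    have : toEuclidean y ∈ Function.support c := hy
    rw [c.support_eq] at this
    exact (Metric.ball_subset_closedBall this)
  refine ⟨fun y => χ y • f y, contDiff_iff_contDiffAt.2 fun y => ?_, ?_⟩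
  · by_cases hy : y ∈ S
    · exact hχ.contDiffAt.smul (hf.contDiffAt (hS.mem_nhds hy))
    · have h0 : χ =ᶠ[𝓝 y] 0 := notMem_tsupport_iff_eventuallyEq.1 fun h => hy (hsupp h)
      refine (contDiffAt_const (c := (0 : F))).congr_of_eventuallyEq ?_
      filter_upwards [h0] with z hz
      simp [hz]
  · have h1 : ∀ᶠ y in 𝓝 x, χ y = 1 :=
      (toEuclidean (E := E)).continuous.continuousAt.eventually c.eventuallyEq_one
    filter_upwards [h1] with y hy
    simp [hy]

lemma contDiff_parametric_intervalIntegral_nat (n : ℕ) {H E : Type} [NormedAddCommGroup H]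
    [NormedSpace ℝ H] [FiniteDimensional ℝ H] [NormedAddCommGroup E] [NormedSpace ℝ E]
    [CompleteSpace E] {F : H × ℝ → E} (hF : ContDiff ℝ (⊤ : ℕ∞) F) :
    ContDiff ℝ n (fun x => ∫ t in (0 : ℝ)..1, F (x, t)) := by
  induction n generalizing E with
  | zero =>
    exact contDiff_zero.2
      (intervalIntegral.continuous_parametric_intervalIntegral_of_continuous'
        (f := fun x t => F (x, t)) hF.continuous 0 1)
  | succ n ih =>
    let F' : H × ℝ → H →L[ℝ] E := fun z => (fderiv ℝ F z).comp (ContinuousLinearMap.inl ℝ H ℝ)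
    have hF' : ContDiff ℝ (⊤ : ℕ∞) F' := (hF.fderiv_right (by simp)).clm_comp contDiff_const
    have hd : ∀ x, HasFDerivAt (fun x => ∫ t in (0 : ℝ)..1, F (x, t))
        (∫ t in (0 : ℝ)..1, F' (x, t)) x := by
      intro x
      obtain ⟨C, hC⟩ := ((isCompact_closedBall x 1).prod (isCompact_Icc (a := (0 : ℝ))
        (b := 1))).exists_bound_of_continuousOn hF'.continuous.continuousOn
      refine intervalIntegral.hasFDerivAt_integral_of_dominated_of_fderiv_le
        (F := fun x t => F (x, t)) (F' := fun x t => F' (x, t)) (bound := fun _ => C)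
        (Metric.closedBall_mem_nhds x one_pos) ?_ ?_ ?_ ?_ ?_ ?_
      · exact .of_forall fun y => (hF.continuous.comp (by fun_prop)).aestronglyMeasurable
      · exact (hF.continuous.comp (by fun_prop : Continuous fun t : ℝ => (x, t))).intervalIntegrable
          _ _
      · exact (hF'.continuous.comp
          (by fun_prop : Continuous fun t : ℝ => (x, t))).aestronglyMeasurable
      · refine .of_forall fun t ht y hy => hC (y, t) ⟨hy, ?_⟩
        rw [uIoc_of_le zero_le_one] at ht
        exact Ioc_subset_Icc_self ht
      · exact intervalIntegrable_const
      · exact .of_forall fun t _ y _ => HasFDerivAt.comp (f := fun y : H => (y, t)) y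
          (hF.differentiable (by simp) (y, t)).hasFDerivAt (hasFDerivAt_prodMk_left y t)
    rw [Nat.cast_succ, contDiff_succ_iff_fderiv]
    refine ⟨fun x => (hd x).differentiableAt, by simp, ?_⟩
    rw [funext fun x => (hd x).fderiv]
    exact ih hF'

lemma contDiff_parametric_intervalIntegral {H E : Type} [NormedAddCommGroup H]
    [NormedSpace ℝ H] [FiniteDimensional ℝ H] [NormedAddCommGroup E] [NormedSpace ℝ E]
    [CompleteSpace E] {F : H × ℝ → E} (hF : ContDiff ℝ (⊤ : ℕ∞) F) :
    ContDiff ℝ (⊤ : ℕ∞) (fun x => ∫ t in (0 : ℝ)..1, F (x, t)) :=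
  contDiff_infty.2 fun n => contDiff_parametric_intervalIntegral_nat n hF

/-- Hadamard's lemma with a parameter. -/
lemma Smooth₂.exists_eq_mul {f : ℝ → ℝ → ℝ} (hf : Smooth₂ f) (h0 : ∀ u, f u 0 = 0) :
    ∃ g : ℝ → ℝ → ℝ, Smooth₂ g ∧ ∀ u w, f u w = w * g u w := by
  refine ⟨fun u w => ∫ t in (0 : ℝ)..1, _root_.pdw f u (t * w), ?_, fun u w => ?_⟩
  · exact contDiff_parametric_intervalIntegral
      (F := fun z : (ℝ × ℝ) × ℝ => _root_.pdw f z.1.1 (z.2 * z.1.2))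
      (hf.pdw.comp (by fun_prop) (by fun_prop))
  · have hd : ∀ t : ℝ, HasDerivAt (fun t => f u (t * w)) (w * _root_.pdw f u (t * w)) t :=
      fun t => (hf.hasDerivAt_comp (hasDerivAt_const t u)
        ((hasDerivAt_id t).mul_const w)).congr_deriv (by simp [mul_comm])
    have hc : Continuous fun t : ℝ => w * _root_.pdw f u (t * w) :=
      continuous_const.mul (hf.pdw.continuous.comp (by fun_prop : Continuous fun t => (u, t * w)))
    have := intervalIntegral.integral_eq_sub_of_hasDerivAt (a := 0) (b := 1) (fun t _ => hd t)
      (hc.intervalIntegrable _ _)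
    rw [intervalIntegral.integral_const_mul] at this
    simp [this, h0]

lemma exists_eq_mul_of_apply_zero {f : ℝ → ℝ} (hf : ContDiff ℝ (⊤ : ℕ∞) f) (h0 : f 0 = 0) :
    ∃ g : ℝ → ℝ, ContDiff ℝ (⊤ : ℕ∞) g ∧ ∀ t, f t = t * g t := by
  obtain ⟨g, hg, h⟩ := Smooth₂.exists_eq_mul (f := fun _ w => f w) (hf.comp contDiff_snd)
    fun _ => h0
  exact ⟨g 0, hg.comp contDiff_const contDiff_id, h 0⟩

lemma deriv_iterate_succ_id_mul {g : ℝ → ℝ} (hg : ContDiff ℝ (⊤ : ℕ∞) g) (k : ℕ) :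
    deriv^[k + 1] (fun t => t * g t) = fun t => t * deriv^[k + 1] g t + (k + 1) * deriv^[k] g t := by
  induction k with
  | zero =>
    funext t
    refine HasDerivAt.deriv
      (((hasDerivAt_id t).mul (hasDerivAt_iterate_deriv hg 0 t)).congr_deriv ?_)
    simp
    ring
  | succ k ih =>
    rw [Function.iterate_succ_apply', ih]
    funext t
    refine HasDerivAt.deriv ((((hasDerivAt_id t).mul (hasDerivAt_iterate_deriv hg (k + 1) t)).add
      ((hasDerivAt_iterate_deriv hg k t).const_mul (k + 1 : ℝ))).congr_deriv ?_)
    simp only [id_eq]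
    push_cast
    ring

/-- Taylor's formula with smooth remainder, for a function with vanishing jet. -/
lemma exists_eq_pow_mul {f : ℝ → ℝ} (hf : ContDiff ℝ (⊤ : ℕ∞) f) (n : ℕ)
    (h0 : ∀ k < n, deriv^[k] f 0 = 0) :
    ∃ g : ℝ → ℝ, ContDiff ℝ (⊤ : ℕ∞) g ∧ (∀ t, f t = t ^ n * g t) ∧
      deriv^[n] f 0 = n.factorial * g 0 := by
  induction n generalizing f with
  | zero => exact ⟨f, hf, by simp, by simp⟩
  | succ n ih =>
    obtain ⟨g, hg, hfg⟩ := exists_eq_mul_of_apply_zero hf (h0 0 n.succ_pos)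
    have hd : ∀ k, deriv^[k + 1] f 0 = (k + 1) * deriv^[k] g 0 := fun k => by
      rw [funext hfg, deriv_iterate_succ_id_mul hg]
      simp
    obtain ⟨r, hr, hgr, hr0⟩ := ih hg fun k hk => by
      have := h0 (k + 1) (by lia)
      rw [hd] at this
      exact (mul_eq_zero.1 this).resolve_left (by positivity)
    refine ⟨r, hr, fun t => by rw [hfg, hgr]; ring, ?_⟩
    rw [hd, hr0, Nat.factorial_succ]
    push_cast
    ring

/-- The smooth inverse function theorem on an open set. -/
lemma exists_smooth_local_inverse {E : Type*} [NormedAddCommGroup E] [NormedSpace ℝ E]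
    [CompleteSpace E] {F : E → E} {S : Set E} {x : E} (hS : IsOpen S) (hx : x ∈ S)
    (hF : ContDiffOn ℝ (⊤ : ℕ∞) F S) (e : E ≃L[ℝ] E) (he : HasFDerivAt F (e : E →L[ℝ] E) x) :
    ∃ P : OpenPartialHomeomorph E E, (∀ y, P y = F y) ∧ x ∈ P.source ∧ P.source ⊆ S ∧
      ContDiffOn ℝ (⊤ : ℕ∞) P.symm P.target := by
  have hFx : ContDiffAt ℝ (⊤ : ℕ∞) F x := hF.contDiffAt (hS.mem_nhds hx)
  have hcont : ContinuousOn (fderiv ℝ F) S := hF.continuousOn_fderiv_of_isOpen hS (by simp)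
  have hnhds : S ∩ fderiv ℝ F ⁻¹' range ((↑) : (E ≃L[ℝ] E) → E →L[ℝ] E) ∈ 𝓝 x := by
    refine Filter.inter_mem (hS.mem_nhds hx)
      ((hcont.continuousAt (hS.mem_nhds hx)).preimage_mem_nhds ?_)
    rw [he.fderiv]
    exact e.nhds
  let P := (hFx.toOpenPartialHomeomorph F he (by simp)).restrOpen
    (interior (S ∩ fderiv ℝ F ⁻¹' range ((↑) : (E ≃L[ℝ] E) → E →L[ℝ] E))) isOpen_interior
  have hsrc : P.source ⊆ S ∩ fderiv ℝ F ⁻¹' range ((↑) : (E ≃L[ℝ] E) → E →L[ℝ] E) :=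
    fun y hy => interior_subset hy.2
  refine ⟨P, fun y => rfl, ⟨hFx.mem_toOpenPartialHomeomorph_source he (by simp),
    mem_interior_iff_mem_nhds.2 hnhds⟩, fun y hy => (hsrc hy).1, fun y hy => ?_⟩
  obtain ⟨hyS, e', he'⟩ := hsrc (P.map_target hy)
  have hFy := hF.contDiffAt (hS.mem_nhds hyS)
  refine (P.contDiffAt_symm (f₀' := e') hy ?_ hFy).contDiffWithinAt
  rw [he']
  exact (hFy.differentiableAt (by simp)).hasFDerivAt

end Tools

section Singularities

lemma Smooth₂.pd_pd {f : ℝ → ℝ → ℝ} (hf : Smooth₂ f) (i j k l : ℕ) :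
    _root_.pd i j (_root_.pd k l f) = _root_.pd (i + k) (j + l) f := by
  have hw : ∀ j, _root_.pdw^[j] (_root_.pd k l f) = _root_.pd k (j + l) f := fun j => by
    induction j with
    | zero => simp
    | succ j ih => rw [Function.iterate_succ_apply', ih, hf.pdw_pd, add_right_comm]
  induction i with
  | zero => simpa [_root_.pd] using hw j
  | succ i ih =>
    rw [← Smooth₂.pdu_pd, ih, Smooth₂.pdu_pd, add_right_comm]

lemma iterate_deriv_congr {f g : ℝ → ℝ} {x : ℝ} (h : f =ᶠ[𝓝 x] g) (n : ℕ) :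
    deriv^[n] f =ᶠ[𝓝 x] deriv^[n] g := by
  induction n with
  | zero => exact h
  | succ n ih => simpa only [Function.iterate_succ_apply'] using ih.deriv

lemma deriv_two_mul {f g : ℝ → ℝ} (hf : ContDiff ℝ (⊤ : ℕ∞) f) (hg : ContDiff ℝ (⊤ : ℕ∞) g)
    (t : ℝ) : deriv^[2] (fun t => f t * g t) t =
      deriv^[2] f t * g t + 2 * deriv^[1] f t * deriv^[1] g t + f t * deriv^[2] g t := by
  have hf' := fun k t => hasDerivAt_iterate_deriv hf k t
  have hg' := fun k t => hasDerivAt_iterate_deriv hg k t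
  have h1 : deriv (fun t => f t * g t) = fun t => deriv^[1] f t * g t + f t * deriv^[1] g t :=
    funext fun t => ((hf' 0 t).mul (hg' 0 t)).deriv
  rw [Function.iterate_succ_apply', Function.iterate_one, h1]
  refine HasDerivAt.deriv
    ((((hf' 1 t).mul (hg' 0 t)).add ((hf' 0 t).mul (hg' 1 t))).congr_deriv ?_)
  simp only [Function.iterate_zero, id_eq, zero_add, Nat.reduceAdd, Function.iterate_one]
  ring

variable {h : ℝ → ℝ → ℝ} {α β : ℝ → ℝ}

lemma deriv_comp_curve_of_crit (hh : Smooth₂ h) (hα : ContDiff ℝ (⊤ : ℕ∞) α)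
    (hβ : ContDiff ℝ (⊤ : ℕ∞) β) (hα0 : α 0 = 0) (hβ0 : β 0 = 0)
    (h10 : pd 1 0 h 0 0 = 0) (h01 : pd 0 1 h 0 0 = 0) :
    deriv^[1] (fun t => h (α t) (β t)) 0 = 0 := by
  rw [Function.iterate_one, deriv_comp_curve hh hα hβ]
  simp [hα0, hβ0, h10, h01]

lemma deriv_two_comp_curve_of_crit (hh : Smooth₂ h) (hα : ContDiff ℝ (⊤ : ℕ∞) α)
    (hβ : ContDiff ℝ (⊤ : ℕ∞) β) (hα0 : α 0 = 0) (hβ0 : β 0 = 0)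
    (h10 : pd 1 0 h 0 0 = 0) (h01 : pd 0 1 h 0 0 = 0)
    (h11 : pd 1 1 h 0 0 = 0) :
    deriv^[2] (fun t => h (α t) (β t)) 0 =
      pd 2 0 h 0 0 * deriv^[1] α 0 ^ 2 + pd 0 2 h 0 0 * deriv^[1] β 0 ^ 2 := by
  rw [deriv_deriv_comp_curve hh hα hβ]
  simp [hα0, hβ0, h10, h01, h11]

lemma deriv_three_comp_curve_of_crit (hh : Smooth₂ h) (hα : ContDiff ℝ (⊤ : ℕ∞) α)
    (hβ : ContDiff ℝ (⊤ : ℕ∞) β) (hα0 : α 0 = 0) (hβ0 : β 0 = 0) (hβ1 : deriv^[1] β 0 = 0)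
    (h10 : pd 1 0 h 0 0 = 0) (h01 : pd 0 1 h 0 0 = 0) (h20 : pd 2 0 h 0 0 = 0)
    (h11 : pd 1 1 h 0 0 = 0) :
    deriv^[3] (fun t => h (α t) (β t)) 0 = pd 3 0 h 0 0 * deriv^[1] α 0 ^ 3 := by
  rw [deriv_three_comp_curve hh hα hβ]
  rw [Function.iterate_one] at *
  simp [hα0, hβ0, hβ1, h10, h01, h20, h11]

lemma deriv_four_comp_curve_of_crit (hh : Smooth₂ h) (hα : ContDiff ℝ (⊤ : ℕ∞) α)
    (hβ : ContDiff ℝ (⊤ : ℕ∞) β) (hα0 : α 0 = 0) (hβ0 : β 0 = 0) (hβ1 : deriv^[1] β 0 = 0)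
    (h10 : pd 1 0 h 0 0 = 0) (h01 : pd 0 1 h 0 0 = 0) (h20 : pd 2 0 h 0 0 = 0)
    (h11 : pd 1 1 h 0 0 = 0) (h30 : pd 3 0 h 0 0 = 0)
    (hβ2 : pd 2 1 h 0 0 * deriv^[1] α 0 ^ 2 + pd 0 2 h 0 0 * deriv^[2] β 0 = 0) :
    deriv^[4] (fun t => h (α t) (β t)) 0 * pd 0 2 h 0 0 =
      (pd 4 0 h 0 0 * pd 0 2 h 0 0 - 3 * pd 2 1 h 0 0 ^ 2) * deriv^[1] α 0 ^ 4 := by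
  rw [deriv_four_comp_curve hh hα hβ hα0 hβ0 hβ1 h10 h01 h11, h20, h30]
  linear_combination (3 * pd 2 1 h 0 0 * deriv^[1] α 0 ^ 2 +
    3 * pd 0 2 h 0 0 * deriv^[2] β 0) * hβ2

/-- At a critical point with Hessian `diag(0, c)`, `c ≠ 0`, an `A_k` normal form (`k ≥ 2`)
provides a curve tangent to the kernel of the Hessian along which `h` is `± y ^ (k + 1)`. -/
lemma HasAkSingAt.exists_curve {k : ℕ} (hk : 2 ≤ k) (hA : HasAkSingAt h k) (hh : Smooth₂ h)
    (h00 : h 0 0 = 0) (h10 : pd 1 0 h 0 0 = 0) (h01 : pd 0 1 h 0 0 = 0)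
    (h20 : pd 2 0 h 0 0 = 0) (h11 : pd 1 1 h 0 0 = 0) (h02 : pd 0 2 h 0 0 ≠ 0) :
    ∃ (α β : ℝ → ℝ) (ε : ℝ), ContDiff ℝ (⊤ : ℕ∞) α ∧ ContDiff ℝ (⊤ : ℕ∞) β ∧ ε ≠ 0 ∧
      α 0 = 0 ∧ β 0 = 0 ∧ deriv^[1] β 0 = 0 ∧ deriv^[1] α 0 ≠ 0 ∧
      ((fun t => h (α t) (β t)) =ᶠ[𝓝 0] fun t => ε * t ^ (k + 1)) ∧
      (pd 3 0 h 0 0 = 0 →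
        pd 2 1 h 0 0 * deriv^[1] α 0 ^ 2 + pd 0 2 h 0 0 * deriv^[2] β 0 = 0) := by
  obtain ⟨U, V, φ, ψ, ε₁, ε₂, hU, hV, h0U, h0V, hφ, hψ, -, -, hψφ, -, hφ0, -, hε₂, hnf⟩ := hA
  obtain ⟨g, hg, hgφ⟩ := exists_contDiff_eventuallyEq hU h0U hφ
  obtain ⟨q, hq, hqψ⟩ := exists_contDiff_eventuallyEq hV h0V hψ
  have hA : Smooth₂ fun x y => (g (x, y)).1 := contDiff_fst.comp hg
  have hB : Smooth₂ fun x y => (g (x, y)).2 := contDiff_snd.comp hg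
  have hP : Smooth₂ fun x y => (q (x, y)).1 := contDiff_fst.comp hq
  have hQ : Smooth₂ fun x y => (q (x, y)).2 := contDiff_snd.comp hq
  have hg0 : g (0, 0) = (0, 0) := hgφ.eq_of_nhds.trans hφ0
  have hqg : ∀ᶠ z in 𝓝 ((0, 0) : ℝ × ℝ), q (g z) = z := by
    have ht : Filter.Tendsto g (𝓝 (0, 0)) (𝓝 (0, 0)) := by
      simpa only [hg0] using hg.continuous.tendsto (0, 0)
    filter_upwards [ht.eventually hqψ, hgφ, hU.mem_nhds h0U] with z h1 h2 h3
    rw [h1, h2, hψφ z h3]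
  have hnfg : ∀ᶠ z in 𝓝 ((0, 0) : ℝ × ℝ),
      h (g z).1 (g z).2 = ε₁ * z.1 ^ 2 + ε₂ * z.2 ^ (k + 1) := by
    filter_upwards [hgφ, hU.mem_nhds h0U] with z h2 h3
    rw [h2, hnf z h3, h00, zero_add]
  set A : ℝ → ℝ → ℝ := fun x y => (g (x, y)).1
  set B : ℝ → ℝ → ℝ := fun x y => (g (x, y)).2
  set P : ℝ → ℝ → ℝ := fun x y => (q (x, y)).1
  set Q : ℝ → ℝ → ℝ := fun x y => (q (x, y)).2
  have hA0 : A 0 0 = 0 := by simp [A, hg0]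
  have hB0 : B 0 0 = 0 := by simp [B, hg0]
  have hα : ContDiff ℝ (⊤ : ℕ∞) (A 0) := hA.comp contDiff_const contDiff_id
  have hβ : ContDiff ℝ (⊤ : ℕ∞) (B 0) := hB.comp contDiff_const contDiff_id
  have hα₁ : ContDiff ℝ (⊤ : ℕ∞) (pdu A 0) := hA.pdu.comp contDiff_const contDiff_id
  have hβ₁ : ContDiff ℝ (⊤ : ℕ∞) (pdu B 0) := hB.pdu.comp contDiff_const contDiff_id
  have hα' := hasDerivAt_iterate_deriv hα 0 0
  have hβ' := hasDerivAt_iterate_deriv hβ 0 0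
  have hx : ∀ {F : ℝ → ℝ → ℝ}, Smooth₂ F → ∀ y, HasDerivAt (fun x => F x y) (pdu F 0 y) 0 :=
    fun hF y => ((ContDiff.differentiable (hF.comp (contDiff_id (𝕜 := ℝ)) contDiff_const)
      (by simp)) 0).hasDerivAt
  have hcy : Filter.Tendsto (fun y : ℝ => ((0, y) : ℝ × ℝ)) (𝓝 0) (𝓝 (0, 0)) :=
    (by fun_prop : Continuous fun y : ℝ => ((0, y) : ℝ × ℝ)).tendsto 0
  have hcx : ∀ y : ℝ, Filter.Tendsto (fun x : ℝ => ((x, y) : ℝ × ℝ)) (𝓝 0) (𝓝 (0, y)) :=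
    fun y => (by fun_prop : Continuous fun x : ℝ => ((x, y) : ℝ × ℝ)).tendsto 0
  have hcurve : (fun t => h (A 0 t) (B 0 t)) =ᶠ[𝓝 0] fun t => ε₂ * t ^ (k + 1) := by
    filter_upwards [hcy.eventually hnfg] with y hy
    simpa using hy
  have hβ1 : deriv^[1] (B 0) 0 = 0 := by
    have h2 := deriv_two_comp_curve_of_crit hh hα hβ hA0 hB0 h10 h01 h11
    rw [(iterate_deriv_congr hcurve 2).eq_of_nhds, h20] at h2
    obtain ⟨m, rfl⟩ := Nat.exists_eq_add_of_le hk
    have : deriv^[2] (fun t : ℝ => ε₂ * t ^ (2 + m + 1)) 0 = 0 := by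
      simp only [← iteratedDeriv_eq_iterate]
      rw [iteratedDeriv_const_mul_field, iteratedDeriv_eq_iterate, iter_deriv_pow]
      simp
    rw [this] at h2
    simpa [h02] using h2.symm
  -- the inverse change of coordinates controls the Jacobian
  have hPx : pdu P 0 0 * pdu A 0 0 + pdw P 0 0 * pdu B 0 0 = 1 := by
    have h1 := hP.hasDerivAt_comp (hx hA 0) (hx hB 0)
    rw [hA0, hB0] at h1
    refine h1.unique ((hasDerivAt_id (0 : ℝ)).congr_of_eventuallyEq ?_)
    filter_upwards [(hcx 0).eventually hqg] with x hx
    exact congrArg Prod.fst hx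
  have hPy : pdu P 0 0 * deriv^[1] (A 0) 0 + pdw P 0 0 * deriv^[1] (B 0) 0 = 0 := by
    have h1 := hP.hasDerivAt_comp hα' hβ'
    simp only [Function.iterate_zero, id_eq, hA0, hB0] at h1
    refine h1.unique ((hasDerivAt_const (0 : ℝ) (0 : ℝ)).congr_of_eventuallyEq ?_)
    filter_upwards [hcy.eventually hqg] with x hx
    exact congrArg Prod.fst hx
  have hQy : pdu Q 0 0 * deriv^[1] (A 0) 0 + pdw Q 0 0 * deriv^[1] (B 0) 0 = 1 := by
    have h1 := hQ.hasDerivAt_comp hα' hβ'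
    simp only [Function.iterate_zero, id_eq, hA0, hB0] at h1
    refine h1.unique ((hasDerivAt_id (0 : ℝ)).congr_of_eventuallyEq ?_)
    filter_upwards [hcy.eventually hqg] with x hx
    exact congrArg Prod.snd hx
  rw [hβ1] at hPy hQy
  have hα1 : deriv^[1] (A 0) 0 ≠ 0 := fun h => by rw [h] at hQy; simp at hQy
  have hP0 : pdu P 0 0 = 0 := by
    rw [mul_zero, add_zero] at hPy
    exact (mul_eq_zero.1 hPy).resolve_right hα1
  have hβ₁0 : pdu B 0 0 ≠ 0 := fun h => by simp [h, hP0] at hPx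
  refine ⟨A 0, B 0, ε₂, hα, hβ, by rcases hε₂ with rfl | rfl <;> simp, hA0, hB0, hβ1, hα1, hcurve,
    fun h30 => ?_⟩
  have hE : (fun y => pd 1 0 h (A 0 y) (B 0 y) * pdu A 0 y + pd 0 1 h (A 0 y) (B 0 y) * pdu B 0 y)
      =ᶠ[𝓝 0] fun _ => 0 := by
    filter_upwards [hcy.eventually (eventually_eventually_nhds.2 hnfg)] with y hy
    have h1 := hh.hasDerivAt_comp (hx hA y) (hx hB y)
    refine h1.unique (HasDerivAt.congr_of_eventuallyEq ?_ ((hcx y).eventually hy))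
    simpa using (((hasDerivAt_pow 2 (0 : ℝ)).const_mul ε₁).add_const (ε₂ * y ^ (k + 1)))
  have h1 := (iterate_deriv_congr hE 2).eq_of_nhds
  have hc10 := (hh.pd 1 0).comp hα hβ
  have hc01 := (hh.pd 0 1).comp hα hβ
  have hadd : deriv^[2] (fun y => pd 1 0 h (A 0 y) (B 0 y) * pdu A 0 y +
      pd 0 1 h (A 0 y) (B 0 y) * pdu B 0 y) 0 =
      deriv^[2] (fun y => pd 1 0 h (A 0 y) (B 0 y) * pdu A 0 y) 0 +
      deriv^[2] (fun y => pd 0 1 h (A 0 y) (B 0 y) * pdu B 0 y) 0 := by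
    simp only [← iteratedDeriv_eq_iterate]
    exact iteratedDeriv_fun_add ((hc10.mul hα₁).of_le (WithTop.coe_le_coe.2 le_top)).contDiffAt
      ((hc01.mul hβ₁).of_le (WithTop.coe_le_coe.2 le_top)).contDiffAt
  rw [hadd, deriv_two_mul hc10 hα₁, deriv_two_mul hc01 hβ₁,
    deriv_deriv_comp_curve (hh.pd 1 0) hα hβ, deriv_deriv_comp_curve (hh.pd 0 1) hα hβ,
    Function.iterate_one, deriv_comp_curve (hh.pd 1 0) hα hβ,
    deriv_comp_curve (hh.pd 0 1) hα hβ] at h1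
  simp only [Function.iterate_one] at h1 hβ1 ⊢
  simp only [hh.pd_pd, hA0, hB0, Nat.reduceAdd, h10, h01, h20, h11, h30, hβ1] at h1
  refine (mul_eq_zero.1 (Eq.trans ?_ (h1.trans ?_))).resolve_right hβ₁0
  · ring
  · simp

end Singularities

section Sufficiency

lemma exists_continuousLinearEquiv_of_det_ne_zero {P' Q' : ℝ × ℝ →L[ℝ] ℝ}
    (hdet : P' (1, 0) * Q' (0, 1) - P' (0, 1) * Q' (1, 0) ≠ 0) :
    ∃ e : (ℝ × ℝ) ≃L[ℝ] ℝ × ℝ, (e : ℝ × ℝ →L[ℝ] ℝ × ℝ) = P'.prod Q' := by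
  have hinj : Function.Injective (P'.prod Q' : ℝ × ℝ →ₗ[ℝ] ℝ × ℝ) := by
    rw [← LinearMap.ker_eq_bot, LinearMap.ker_eq_bot']
    rintro ⟨x, y⟩ hxy
    have hsplit : ((x, y) : ℝ × ℝ) = x • (1, 0) + y • (0, 1) := by simp
    have h1 : P' (x, y) = 0 := congrArg Prod.fst hxy
    have h2 : Q' (x, y) = 0 := congrArg Prod.snd hxy
    rw [hsplit, map_add, map_smul, map_smul, smul_eq_mul, smul_eq_mul] at h1 h2
    have hx : x = 0 := by
      refine (mul_eq_zero.1 ?_).resolve_right hdet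
      linear_combination Q' (0, 1) * h1 - P' (0, 1) * h2
    have hy : y = 0 := by
      refine (mul_eq_zero.1 ?_).resolve_right hdet
      linear_combination P' (1, 0) * h2 - Q' (1, 0) * h1
    rw [hx, hy, Prod.mk_zero_zero]
  refine ⟨(LinearEquiv.ofInjectiveEndo _ hinj).toContinuousLinearEquiv, ?_⟩
  ext <;> rfl

/-- The implicit function theorem, with a globally defined smooth solution. -/
lemma Smooth₂.exists_implicit {f : ℝ → ℝ → ℝ} (hf : Smooth₂ f) (h0 : f 0 0 = 0)
    (hw : _root_.pdw f 0 0 ≠ 0) :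
    ∃ β : ℝ → ℝ, ContDiff ℝ (⊤ : ℕ∞) β ∧ β 0 = 0 ∧ ∀ᶠ u in 𝓝 0, f u (β u) = 0 := by
  obtain ⟨e, he⟩ := exists_continuousLinearEquiv_of_det_ne_zero
    (P' := ContinuousLinearMap.fst ℝ ℝ ℝ)
    (Q' := fderiv ℝ (fun x : ℝ × ℝ => f x.1 x.2) (0, 0)) (by simpa [← hf.pdw_eq] using hw)
  obtain ⟨P, hP, h0P, -, hPs⟩ := exists_smooth_local_inverse (F := fun z : ℝ × ℝ => (z.1, f z.1 z.2))
    isOpen_univ (mem_univ (0, 0)) (contDiff_fst.prodMk hf).contDiffOn e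
    (he ▸ hasFDerivAt_fst.prodMk (hf.hasFDerivAt (0, 0)))
  have hι : ContDiff ℝ (⊤ : ℕ∞) (fun u : ℝ => ((u, 0) : ℝ × ℝ)) := contDiff_id.prodMk contDiff_const
  have hP0 : P (0, 0) = (0, 0) := by rw [hP]; exact Prod.ext rfl h0
  have hT : IsOpen ((fun u : ℝ => ((u, 0) : ℝ × ℝ)) ⁻¹' P.target) :=
    P.open_target.preimage hι.continuous
  have h0T : (0 : ℝ) ∈ (fun u : ℝ => ((u, 0) : ℝ × ℝ)) ⁻¹' P.target := by
    simpa only [mem_preimage, hP0] using P.map_source h0P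
  have hs0 : P.symm (0, 0) = (0, 0) := by simpa only [hP0] using P.left_inv h0P
  obtain ⟨β, hβ, hβP⟩ := exists_contDiff_eventuallyEq (f := fun u : ℝ => (P.symm (u, 0)).2) hT h0T
    (contDiff_snd.comp_contDiffOn (hPs.comp hι.contDiffOn fun _ h => h))
  refine ⟨β, hβ, by rw [hβP.eq_of_nhds, hs0], ?_⟩
  filter_upwards [hβP, hT.mem_nhds h0T] with u hu huT
  have h1 := P.right_inv huT
  rw [hP] at h1
  have h2 : (P.symm (u, 0)).1 = u := congrArg Prod.fst h1
  have h3 : f (P.symm (u, 0)).1 (P.symm (u, 0)).2 = 0 := congrArg Prod.snd h1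
  rwa [h2, ← hu] at h3

variable {h : ℝ → ℝ → ℝ} {β : ℝ → ℝ}

/-- Second-order Taylor expansion in `w` around the graph of `β`. -/
lemma Smooth₂.exists_taylor_two (hh : Smooth₂ h) (hβ : ContDiff ℝ (⊤ : ℕ∞) β) :
    ∃ E : ℝ → ℝ → ℝ, Smooth₂ E ∧
      (∀ u v, h u (v + β u) = h u (β u) + v * _root_.pd 0 1 h u (β u) + v ^ 2 * E u v) := by
  have hβ₂ : ContDiff ℝ (⊤ : ℕ∞) (fun x : ℝ × ℝ => β x.1) := hβ.comp contDiff_fst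
  have hf : Smooth₂ fun u v => h u (v + β u) - h u (β u) :=
    (hh.comp contDiff_fst (contDiff_snd.add hβ₂)).sub (hh.comp contDiff_fst hβ₂)
  obtain ⟨g, hg, hfg⟩ := hf.exists_eq_mul fun u => by simp
  have hg0 : ∀ u, g u 0 = _root_.pd 0 1 h u (β u) := fun u => by
    have h1 : HasDerivAt (fun v => h u (v + β u) - h u (β u)) (_root_.pdw h u (β u)) 0 := by
      simpa using (hh.hasDerivAt_comp (hasDerivAt_const (0 : ℝ) u)
        ((hasDerivAt_id (0 : ℝ)).add_const (β u))).sub_const (h u (β u))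
    have h2 : HasDerivAt (fun v => v * g u v) (g u 0) 0 :=
      ((hasDerivAt_id (0 : ℝ)).mul (hg.hasDerivAt_comp (hasDerivAt_const (0 : ℝ) u)
        (hasDerivAt_id (0 : ℝ)))).congr_deriv (by simp)
    simp only [← hfg] at h2
    exact h2.unique h1
  obtain ⟨E, hE, hgE⟩ := Smooth₂.exists_eq_mul (f := fun u v => g u v - g u 0)
    (ContDiff.sub hg (hg.comp contDiff_fst contDiff_const)) fun u => sub_self _
  refine ⟨E, hE, fun u v => ?_⟩
  linear_combination hfg u v + v * hgE u v + v * hg0 u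

lemma exists_sign_mul_pos {x : ℝ} (hx : x ≠ 0) : ∃ ε : ℝ, (ε = 1 ∨ ε = -1) ∧ 0 < ε * x := by
  rcases hx.lt_or_gt with h | h
  · exact ⟨-1, Or.inr rfl, by linarith⟩
  · exact ⟨1, Or.inl rfl, by linarith⟩

/-- Splitting lemma: if `β` parametrizes the zeros of `∂_w h`, then the order of vanishing of
`u ↦ h u (β u)` is the type of the singularity. -/
lemma hasAkSingAt_of_deriv_comp_curve {k : ℕ} (hh : Smooth₂ h) (hβ : ContDiff ℝ (⊤ : ℕ∞) β)
    (hβ0 : β 0 = 0) (hcrit : ∀ᶠ u in 𝓝 0, pd 0 1 h u (β u) = 0) (h02 : pd 0 2 h 0 0 ≠ 0)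
    (h0 : ∀ j < k + 1, deriv^[j] (fun u => h u (β u)) 0 = 0)
    (hk : deriv^[k + 1] (fun u => h u (β u)) 0 ≠ 0) : HasAkSingAt h k := by
  obtain ⟨E, hE, hT⟩ := hh.exists_taylor_two hβ
  obtain ⟨r, hr, hKr, hr0⟩ := exists_eq_pow_mul
    (show ContDiff ℝ (⊤ : ℕ∞) fun u => h u (β u) from hh.comp contDiff_id hβ) (k + 1) h0
  have h00 : h 0 0 = 0 := by simpa [hβ0] using h0 0 k.succ_pos
  have hE0 : E 0 0 ≠ 0 := by
    have hc := hcrit.self_of_nhds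
    have h1 : h 0 = fun v => v * (v * E 0 v) := funext fun v => by
      have := hT 0 v
      rw [hc, hβ0, add_zero, h00] at this
      rw [this]; ring
    have h2 : deriv^[2] (h 0) 0 = 2 * E 0 0 := by
      have hE' : ContDiff ℝ (⊤ : ℕ∞) (E 0) := hE.comp contDiff_const contDiff_id
      rw [h1, deriv_iterate_succ_id_mul (g := fun v => v * E 0 v) (contDiff_id.mul hE') 1,
        deriv_iterate_succ_id_mul hE' 0]
      norm_num
    intro h3
    rw [h3, mul_zero] at h2
    exact h02 h2
  have hr0' : r 0 ≠ 0 := fun h3 => hk (by rw [hr0, h3, mul_zero])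
  obtain ⟨ε₁, hε₁, hpos₁⟩ := exists_sign_mul_pos hE0
  obtain ⟨ε₂, hε₂, hpos₂⟩ := exists_sign_mul_pos hr0'
  have hβ₂ : ContDiff ℝ (⊤ : ℕ∞) (fun z : ℝ × ℝ => β z.1) := hβ.comp contDiff_fst
  have hv : ContDiff ℝ (⊤ : ℕ∞) (fun z : ℝ × ℝ => z.2 - β z.1) := contDiff_snd.sub hβ₂
  have hA : ContDiff ℝ (⊤ : ℕ∞) (fun z : ℝ × ℝ => ε₁ * E z.1 (z.2 - β z.1)) :=
    contDiff_const.mul (hE.comp contDiff_fst hv)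
  have hB : ContDiff ℝ (⊤ : ℕ∞) (fun z : ℝ × ℝ => ε₂ * r z.1) :=
    contDiff_const.mul (hr.comp contDiff_fst)
  obtain ⟨T, hTsub, hTo, h0T⟩ := eventually_nhds_iff.1 hcrit
  let A : ℝ × ℝ → ℝ := fun z => √(ε₁ * E z.1 (z.2 - β z.1))
  let B : ℝ × ℝ → ℝ := fun z => (ε₂ * r z.1) ^ ((k + 1 : ℕ) : ℝ)⁻¹
  let S : Set (ℝ × ℝ) := {z | 0 < ε₁ * E z.1 (z.2 - β z.1)} ∩ {z | 0 < ε₂ * r z.1} ∩ Prod.fst ⁻¹' T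
  have hS : IsOpen S := ((isOpen_lt continuous_const hA.continuous).inter
    (isOpen_lt continuous_const hB.continuous)).inter (hTo.preimage continuous_fst)
  have h0S : ((0, 0) : ℝ × ℝ) ∈ S := ⟨⟨by simpa [hβ0] using hpos₁, hpos₂⟩, h0T⟩
  have hAS : ContDiffOn ℝ (⊤ : ℕ∞) A S := hA.contDiffOn.sqrt fun z hz => hz.1.1.ne'
  have hBS : ContDiffOn ℝ (⊤ : ℕ∞) B S := hB.contDiffOn.rpow_const_of_ne fun z hz => hz.1.2.ne'
  have hd : ∀ {f : ℝ × ℝ → ℝ}, ContDiffOn ℝ (⊤ : ℕ∞) f S → HasFDerivAt f (fderiv ℝ f (0, 0)) (0, 0) :=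
    fun hf => ((hf.contDiffAt (hS.mem_nhds h0S)).differentiableAt (by simp)).hasFDerivAt
  have hvd : HasFDerivAt (fun z : ℝ × ℝ => z.2 - β z.1)
      (ContinuousLinearMap.snd ℝ ℝ ℝ - deriv β 0 • ContinuousLinearMap.fst ℝ ℝ ℝ) (0, 0) :=
    hasFDerivAt_snd.sub (HasDerivAt.comp_hasFDerivAt (h₂ := β) ((0, 0) : ℝ × ℝ)
      (hβ.differentiable (by simp) 0).hasDerivAt hasFDerivAt_fst)
  have hΦ₁ := (hd hAS).mul hvd
  have hΦ₂ := (hasFDerivAt_fst (𝕜 := ℝ) (p := ((0, 0) : ℝ × ℝ))).mul (hd hBS)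
  have hA0 : 0 < A (0, 0) := Real.sqrt_pos.2 h0S.1.1
  have hB0 : 0 < B (0, 0) := Real.rpow_pos_of_pos h0S.1.2 _
  obtain ⟨e, he⟩ := exists_continuousLinearEquiv_of_det_ne_zero
    (P' := A (0, 0) • (ContinuousLinearMap.snd ℝ ℝ ℝ - deriv β 0 • ContinuousLinearMap.fst ℝ ℝ ℝ) +
      ((0 : ℝ) - β 0) • fderiv ℝ A (0, 0))
    (Q' := (0 : ℝ) • fderiv ℝ B (0, 0) + B (0, 0) • ContinuousLinearMap.fst ℝ ℝ ℝ)
    (by simp [hβ0, hA0.ne', hB0.ne'])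
  obtain ⟨P, hP, h0P, hPS, hPs⟩ := exists_smooth_local_inverse
    (F := fun z : ℝ × ℝ => (A z * (z.2 - β z.1), z.1 * B z)) hS h0S
    ((hAS.mul hv.contDiffOn).prodMk (contDiff_fst.contDiffOn.mul hBS)) e
    (he ▸ hΦ₁.prodMk hΦ₂)
  have hP0 : P (0, 0) = (0, 0) := by rw [hP]; simp [hβ0]
  have hnf : ∀ z ∈ S, h z.1 z.2 = h 0 0 + ε₁ * (A z * (z.2 - β z.1)) ^ 2 +
      ε₂ * (z.1 * B z) ^ (k + 1) := fun z hz => by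
    have h1 := hT z.1 (z.2 - β z.1)
    have hAz : A z ^ 2 = ε₁ * E z.1 (z.2 - β z.1) := Real.sq_sqrt hz.1.1.le
    have hBz : B z ^ (k + 1) = ε₂ * r z.1 := Real.rpow_inv_natCast_pow hz.1.2.le k.succ_ne_zero
    have hs₁ : ε₁ ^ 2 = 1 := by rcases hε₁ with rfl | rfl <;> norm_num
    have hs₂ : ε₂ ^ 2 = 1 := by rcases hε₂ with rfl | rfl <;> norm_num
    have hK := hKr z.1
    rw [sub_add_cancel, hTsub _ hz.2, hK] at h1
    rw [h1, h00, mul_pow, mul_pow, hAz, hBz]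
    linear_combination (-(z.2 - β z.1) ^ 2 * E z.1 (z.2 - β z.1)) * hs₁ - z.1 ^ (k + 1) * r z.1 * hs₂
  refine ⟨P.target, P.source, P.symm, P, ε₁, ε₂, P.open_target, P.open_source, ?_, h0P, hPs, ?_,
    P.mapsTo_symm, P.mapsTo, fun x hx => P.right_inv hx, fun y hy => P.left_inv hy, ?_, hε₁, hε₂,
    fun x hx => ?_⟩
  · simpa only [hP0] using P.map_source h0P
  · exact (((hAS.mul hv.contDiffOn).prodMk (contDiff_fst.contDiffOn.mul hBS)).mono hPS).congr
      fun z _ => hP z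
  · simpa only [hP0] using P.left_inv h0P
  · rw [hnf _ (hPS (P.map_target hx))]
    have h1 := P.right_inv hx
    rw [hP] at h1
    rw [← congrArg Prod.fst h1, ← congrArg Prod.snd h1]

lemma exists_critical_graph (hh : Smooth₂ h) (h01 : pd 0 1 h 0 0 = 0) (h11 : pd 1 1 h 0 0 = 0)
    (h02 : pd 0 2 h 0 0 ≠ 0) :
    ∃ β : ℝ → ℝ, ContDiff ℝ (⊤ : ℕ∞) β ∧ β 0 = 0 ∧ deriv^[1] β 0 = 0 ∧
      pd 2 1 h 0 0 + pd 0 2 h 0 0 * deriv^[2] β 0 = 0 ∧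
      ∀ᶠ u in 𝓝 0, pd 0 1 h u (β u) = 0 := by
  obtain ⟨β, hβ, hβ0, hcrit⟩ := (hh.pd 0 1).exists_implicit h01 (by rwa [hh.pdw_pd])
  have hz : (fun u => pd 0 1 h (id u) (β u)) =ᶠ[𝓝 0] fun _ => 0 := hcrit
  have hid : ContDiff ℝ (⊤ : ℕ∞) (id : ℝ → ℝ) := contDiff_id
  have h1 := (iterate_deriv_congr hz 1).eq_of_nhds
  have h2 := (iterate_deriv_congr hz 2).eq_of_nhds
  rw [deriv_deriv_comp_curve (hh.pd 0 1) hid hβ] at h2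
  rw [Function.iterate_one, deriv_comp_curve (hh.pd 0 1) hid hβ] at h1
  simp only [hh.pd_pd, hβ0, id_eq, Nat.reduceAdd, h11, Function.iterate_one, deriv_id',
    deriv_const'] at h1 h2
  have hβ1 : deriv β 0 = 0 := by simpa [h02] using h1
  refine ⟨β, hβ, hβ0, hβ1, ?_, hcrit⟩
  simpa [hβ1, h01, Function.iterate_succ] using h2

lemma deriv_iterate_const_mul_pow (c : ℝ) (m j : ℕ) :
    deriv^[j] (fun t : ℝ => c * t ^ m) 0 = if j = m then c * m.factorial else 0 := by
  rw [← iteratedDeriv_eq_iterate, iteratedDeriv_const_mul_field, iteratedDeriv_fun_pow_zero]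
  split_ifs <;> simp

/-- Derivative criterion for `A₂` at a critical point with Hessian `diag(0, c)`, `c ≠ 0`. -/
lemma hasAkSingAt_two_iff (hh : Smooth₂ h)
    (h00 : h 0 0 = 0) (h10 : pd 1 0 h 0 0 = 0) (h01 : pd 0 1 h 0 0 = 0)
    (h20 : pd 2 0 h 0 0 = 0) (h11 : pd 1 1 h 0 0 = 0) (h02 : pd 0 2 h 0 0 ≠ 0) :
    HasAkSingAt h 2 ↔ pd 3 0 h 0 0 ≠ 0 := by
  have hid : ContDiff ℝ (⊤ : ℕ∞) (id : ℝ → ℝ) := contDiff_id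
  constructor
  · intro hA h30
    obtain ⟨α, β, ε, hα, hβ, hε, hα0, hβ0, hβ1, hα1, hc, -⟩ :=
      hA.exists_curve le_rfl hh h00 h10 h01 h20 h11 h02
    have h3 := deriv_three_comp_curve_of_crit hh hα hβ hα0 hβ0 hβ1 h10 h01 h20 h11
    rw [(iterate_deriv_congr hc 3).eq_of_nhds, deriv_iterate_const_mul_pow, h30] at h3
    simp [hε, Nat.factorial_ne_zero] at h3
  · intro h30
    obtain ⟨β, hβ, hβ0, hβ1, -, hcrit⟩ := exists_critical_graph hh h01 h11 h02
    refine hasAkSingAt_of_deriv_comp_curve hh hβ hβ0 hcrit h02 (fun j hj => ?_) ?_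
    · interval_cases j
      · simpa [hβ0] using h00
      · exact deriv_comp_curve_of_crit hh hid hβ rfl hβ0 h10 h01
      · refine (deriv_two_comp_curve_of_crit hh hid hβ rfl hβ0 h10 h01 h11).trans ?_
        rw [h20, hβ1]; ring
    · refine (deriv_three_comp_curve_of_crit hh hid hβ rfl hβ0 hβ1 h10 h01 h20 h11).trans_ne ?_
      simpa using h30

/-- Derivative criterion for `A₃` at a critical point with Hessian `diag(0, c)`, `c ≠ 0`. -/
lemma hasAkSingAt_three_iff (hh : Smooth₂ h)
    (h00 : h 0 0 = 0) (h10 : pd 1 0 h 0 0 = 0) (h01 : pd 0 1 h 0 0 = 0)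
    (h20 : pd 2 0 h 0 0 = 0) (h11 : pd 1 1 h 0 0 = 0) (h02 : pd 0 2 h 0 0 ≠ 0) :
    HasAkSingAt h 3 ↔ pd 3 0 h 0 0 = 0 ∧
      pd 4 0 h 0 0 * pd 0 2 h 0 0 - 3 * pd 2 1 h 0 0 ^ 2 ≠ 0 := by
  have hid : ContDiff ℝ (⊤ : ℕ∞) (id : ℝ → ℝ) := contDiff_id
  constructor
  · intro hA
    obtain ⟨α, β, ε, hα, hβ, hε, hα0, hβ0, hβ1, hα1, hc, hβ2⟩ :=
      hA.exists_curve (by norm_num) hh h00 h10 h01 h20 h11 h02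
    have h3 := deriv_three_comp_curve_of_crit hh hα hβ hα0 hβ0 hβ1 h10 h01 h20 h11
    rw [(iterate_deriv_congr hc 3).eq_of_nhds, deriv_iterate_const_mul_pow,
      if_neg (by norm_num)] at h3
    have h30 : pd 3 0 h 0 0 = 0 := (mul_eq_zero.1 h3.symm).resolve_right (pow_ne_zero 3 hα1)
    have h4 := deriv_four_comp_curve_of_crit hh hα hβ hα0 hβ0 hβ1 h10 h01 h20 h11 h30 (hβ2 h30)
    rw [(iterate_deriv_congr hc 4).eq_of_nhds, deriv_iterate_const_mul_pow] at h4
    refine ⟨h30, fun h5 => ?_⟩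
    rw [h5] at h4
    simp [hε, h02, Nat.factorial_ne_zero] at h4
  · rintro ⟨h30, h4⟩
    obtain ⟨β, hβ, hβ0, hβ1, hβ2, hcrit⟩ := exists_critical_graph hh h01 h11 h02
    refine hasAkSingAt_of_deriv_comp_curve hh hβ hβ0 hcrit h02 (fun j hj => ?_) fun h5 => h4 ?_
    · interval_cases j
      · simpa [hβ0] using h00
      · exact deriv_comp_curve_of_crit hh hid hβ rfl hβ0 h10 h01
      · refine (deriv_two_comp_curve_of_crit hh hid hβ rfl hβ0 h10 h01 h11).trans ?_
        rw [h20, hβ1]; ring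
      · refine (deriv_three_comp_curve_of_crit hh hid hβ rfl hβ0 hβ1 h10 h01 h20 h11).trans ?_
        rw [h30, zero_mul]
    · have h6 := deriv_four_comp_curve_of_crit hh hid hβ rfl hβ0 hβ1 h10 h01 h20 h11 h30
        (by simpa using hβ2)
      simp only [id_eq] at h6
      rw [h5] at h6
      simpa using h6.symm

end Sufficiency

section Torsion

lemma iterate_deriv_linear_combination {P Q : ℝ → ℝ} (hP : ContDiff ℝ (⊤ : ℕ∞) P)
    (hQ : ContDiff ℝ (⊤ : ℕ∞) Q) (x y : ℝ) (k : ℕ) :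
    deriv^[k] (fun t => x * P t + y * Q t) = fun t => x * deriv^[k] P t + y * deriv^[k] Q t := by
  induction k with
  | zero => rfl
  | succ k ih =>
    rw [Function.iterate_succ_apply', ih]
    exact funext fun t => (((hasDerivAt_iterate_deriv hP k t).const_mul x).add
      ((hasDerivAt_iterate_deriv hQ k t).const_mul y)).deriv

lemma Smooth₂.hasDerivAt_left {f : ℝ → ℝ → ℝ} (hf : Smooth₂ f) (u w : ℝ) :
    HasDerivAt (fun t => f t w) (_root_.pdu f u w) u := by
  simpa using hf.hasDerivAt_comp (hasDerivAt_id u) (hasDerivAt_const u w)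

lemma Smooth₂.hasDerivAt_right {f : ℝ → ℝ → ℝ} (hf : Smooth₂ f) (u w : ℝ) :
    HasDerivAt (f u) (_root_.pdw f u w) w := by
  simpa using hf.hasDerivAt_comp (hasDerivAt_const w u) (hasDerivAt_id w)

lemma pd_linear_combination {f g : ℝ → ℝ → ℝ} (hf : Smooth₂ f) (hg : Smooth₂ g) (x y : ℝ)
    (i j : ℕ) :
    pd i j (fun u w => x * f u w + y * g u w) = fun u w => x * pd i j f u w + y * pd i j g u w := by
  induction i with
  | zero =>
    induction j with
    | zero => rfl
    | succ j ih =>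
      rw [show pd 0 (j + 1) (fun u w => x * f u w + y * g u w) =
        pdw (pd 0 j fun u w => x * f u w + y * g u w) from Function.iterate_succ_apply' .., ih]
      funext u w
      rw [← hf.pdw_pd, ← hg.pdw_pd]
      exact ((((hf.pd 0 j).hasDerivAt_right u w).const_mul x).add
        (((hg.pd 0 j).hasDerivAt_right u w).const_mul y)).deriv
  | succ i ih =>
    rw [← Smooth₂.pdu_pd, ih]
    funext u w
    rw [← Smooth₂.pdu_pd, ← Smooth₂.pdu_pd]
    exact ((((hf.pd i j).hasDerivAt_left u w).const_mul x).add
      (((hg.pd i j).hasDerivAt_left u w).const_mul y)).deriv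

lemma pdu_prodMk {f g k : ℝ → ℝ → ℝ} (hf : Smooth₂ f) (hg : Smooth₂ g) (hk : Smooth₂ k) :
    pdu (fun u w => (f u w, g u w, k u w)) = fun u w => (pdu f u w, pdu g u w, pdu k u w) :=
  funext₂ fun u w => ((hf.hasDerivAt_left u w).prodMk
    ((hg.hasDerivAt_left u w).prodMk (hk.hasDerivAt_left u w))).deriv

lemma pdw_prodMk {f g k : ℝ → ℝ → ℝ} (hf : Smooth₂ f) (hg : Smooth₂ g) (hk : Smooth₂ k) :
    pdw (fun u w => (f u w, g u w, k u w)) = fun u w => (pdw f u w, pdw g u w, pdw k u w) :=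
  funext₂ fun u w => ((hf.hasDerivAt_right u w).prodMk
    ((hg.hasDerivAt_right u w).prodMk (hk.hasDerivAt_right u w))).deriv

variable {p q : ℝ → ℝ → ℝ}

lemma sigmaFun_eq (hp : Smooth₂ p) (hq : Smooth₂ q) (u w : ℝ) :
    SigmaFun p q u w =
      (-pd 2 0 p u w * pd 0 1 q u w + pd 2 0 q u w * pd 0 1 p u w) *
        (-pd 0 2 p u w * pd 0 1 q u w + pd 0 2 q u w * pd 0 1 p u w) -
      (-pd 1 1 p u w * pd 0 1 q u w + pd 1 1 q u w * pd 0 1 p u w) ^ 2 := by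
  have hc : ∀ c : ℝ, Smooth₂ fun _ _ => c := fun c => contDiff_const
  have hfst : Smooth₂ fun u _ => u := contDiff_fst
  have hu : pdu (gmap p q) = fun u w => (1, pdu p u w, pdu q u w) := by
    refine (pdu_prodMk hfst hp hq).trans ?_
    simp [pdu]
  have hw : pdw (gmap p q) = fun u w => (0, pdw p u w, pdw q u w) := by
    refine (pdw_prodMk hfst hp hq).trans ?_
    simp [pdw]
  have h0 : ∀ c, pdu (fun _ _ : ℝ => (c : ℝ)) = fun _ _ => 0 :=
    fun c => funext₂ fun u _ => deriv_const u c
  have h0' : ∀ c, pdw (fun _ _ : ℝ => (c : ℝ)) = fun _ _ => 0 :=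
    fun c => funext₂ fun _ w => deriv_const w c
  simp only [SigmaFun, pd, Function.iterate_succ_apply', Function.iterate_zero, id_eq, hu, hw,
    pdu_prodMk (hc _) hp.pdu hq.pdu, pdu_prodMk (hc _) hp.pdw hq.pdw,
    pdw_prodMk (hc _) hp.pdw hq.pdw, h0, h0', dot3, cross3]
  ring

lemma eq_zero_of_eventually_pow_mul_eq_zero {Z : ℝ → ℝ} (hZ : Continuous Z) {m : ℕ}
    (h : ∀ᶠ t in 𝓝 0, t ^ m * Z t = 0) : Z 0 = 0 := by
  have h1 : Filter.Tendsto Z (𝓝[≠] 0) (𝓝 (Z 0)) := hZ.continuousAt.mono_left nhdsWithin_le_nhds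
  refine tendsto_nhds_unique (h1.congr' ?_) tendsto_const_nhds
  filter_upwards [h.filter_mono nhdsWithin_le_nhds, self_mem_nhdsWithin] with t ht ht0
  exact (mul_eq_zero.1 ht).resolve_left (pow_ne_zero m ht0)

/-- A branch of the parabolic set tangent to the `u`-axis has its 2-jet determined by `a₂₁ ≠ 0`. -/
lemma deriv_two_of_sigmaFun_eq_zero (hp : Smooth₂ p) (hq : Smooth₂ q) {φ : ℝ → ℝ}
    (hφ : ContDiff ℝ (⊤ : ℕ∞) φ) (hφ0 : φ 0 = 0) (hφ1 : deriv^[1] φ 0 = 0)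
    (hS : ∀ᶠ t in 𝓝 0, SigmaFun p q t (φ t) = 0)
    (hp01 : pd 0 1 p 0 0 = 0) (hq01 : pd 0 1 q 0 0 = 0) (hp11 : pd 1 1 p 0 0 = 0)
    (hq11 : pd 1 1 q 0 0 = 0) (hp02 : pd 0 2 p 0 0 = 1) (hq02 : pd 0 2 q 0 0 = 0)
    (hp21 : pd 2 1 p 0 0 = 0) (hq21 : pd 2 1 q 0 0 ≠ 0) :
    pd 2 0 p 0 0 * pd 2 1 q 0 0 = pd 2 0 q 0 0 * deriv^[2] φ 0 := by
  have hid : ContDiff ℝ (⊤ : ℕ∞) (id : ℝ → ℝ) := contDiff_id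
  rw [Function.iterate_one] at hφ1
  have hjet : ∀ {f : ℝ → ℝ → ℝ}, Smooth₂ f → pd 0 1 f 0 0 = 0 → pd 1 1 f 0 0 = 0 →
      (∀ k < 2, deriv^[k] (fun t => pd 0 1 f t (φ t)) 0 = 0) ∧
      deriv^[2] (fun t => pd 0 1 f t (φ t)) 0 = pd 2 1 f 0 0 + pd 0 2 f 0 0 * deriv^[2] φ 0 := by
    intro f hf h01 h11
    have h1 := congrFun (deriv_comp_curve (hf.pd 0 1) hid hφ) 0
    have h2 := congrFun (deriv_deriv_comp_curve (hf.pd 0 1) hid hφ) 0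
    simp only [hf.pd_pd, id_eq, Nat.reduceAdd, hφ0, h11, Function.iterate_one, hφ1,
      deriv_id'] at h1 h2
    refine ⟨fun k hk => ?_, by simpa using h2⟩
    interval_cases k
    · simpa [hφ0] using h01
    · simpa using h1
  obtain ⟨hp0, hp2⟩ := hjet hp hp01 hp11
  obtain ⟨hq0, hq2⟩ := hjet hq hq01 hq11
  obtain ⟨r, hr, hpr, hr0⟩ := exists_eq_pow_mul (hp.pd_smooth_comp 0 1 hid hφ) 2 hp0
  obtain ⟨s, hs, hqs, hs0⟩ := exists_eq_pow_mul (hq.pd_smooth_comp 0 1 hid hφ) 2 hq0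
  simp only [id_eq] at hpr hqs hr0 hs0
  rw [hp2, hp21, hp02, zero_add, one_mul] at hr0
  rw [hq2, hq02, zero_mul, add_zero] at hs0
  have hZ := eq_zero_of_eventually_pow_mul_eq_zero (m := 4) (Z := fun t =>
    (-pd 2 0 p t (φ t) * s t + pd 2 0 q t (φ t) * r t) *
      (-pd 0 2 p t (φ t) * s t + pd 0 2 q t (φ t) * r t) -
    (-pd 1 1 p t (φ t) * s t + pd 1 1 q t (φ t) * r t) ^ 2) (by
      have hc : ∀ {f : ℝ → ℝ → ℝ}, Smooth₂ f → ∀ i j, Continuous fun t => pd i j f t (φ t) :=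
        fun hf i j => (hf.pd_smooth_comp i j hid hφ).continuous
      have := hc hp 2 0
      have := hc hp 0 2
      have := hc hp 1 1
      have := hc hq 2 0
      have := hc hq 0 2
      have := hc hq 1 1
      have := hr.continuous
      have := hs.continuous
      fun_prop) (by
    filter_upwards [hS] with t ht
    rw [sigmaFun_eq hp hq, hpr, hqs] at ht
    linear_combination ht)
  simp only [hφ0, hp11, hq11, hp02, hq02] at hZ
  have hs : s 0 ≠ 0 := fun h => hq21 (by rw [hs0, h, mul_zero])
  rw [hs0, hr0]
  refine mul_left_cancel₀ hs ?_
  linear_combination Nat.factorial 2 * hZ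

/-- Derivatives of a curve that is a graph over the first coordinate axis. -/
lemma derivs_graph {P Q : ℝ → ℝ} (hP : ContDiff ℝ (⊤ : ℕ∞) P) (hQ : ContDiff ℝ (⊤ : ℕ∞) Q) :
    deriv (fun t => (t, P t, Q t)) = (fun t => (1, deriv^[1] P t, deriv^[1] Q t)) ∧
    deriv (deriv fun t => (t, P t, Q t)) = (fun t => (0, deriv^[2] P t, deriv^[2] Q t)) ∧
    deriv (deriv (deriv fun t => (t, P t, Q t))) =
      (fun t => (0, deriv^[3] P t, deriv^[3] Q t)) := by
  have hstep : ∀ (k : ℕ) {x : ℝ → ℝ} {c : ℝ}, (∀ t, HasDerivAt x c t) →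
      deriv (fun t => (x t, deriv^[k] P t, deriv^[k] Q t)) =
        fun t => (c, deriv^[k + 1] P t, deriv^[k + 1] Q t) :=
    fun k _ _ hx => funext fun t => ((hx t).prodMk ((hasDerivAt_iterate_deriv hP k t).prodMk
      (hasDerivAt_iterate_deriv hQ k t))).deriv
  have h1 := hstep 0 fun t => hasDerivAt_id' t
  have h2 := hstep 1 fun t => hasDerivAt_const t (1 : ℝ)
  have h3 := hstep 2 fun t => hasDerivAt_const t (0 : ℝ)
  simp only [Function.iterate_zero, id_eq, zero_add] at h1
  exact ⟨h1, by rw [h1, h2], by rw [h1, h2, h3]⟩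

lemma tor_graph {P Q : ℝ → ℝ} (hP : ContDiff ℝ (⊤ : ℕ∞) P) (hQ : ContDiff ℝ (⊤ : ℕ∞) Q) :
    tor (fun t => (t, P t, Q t)) = fun t =>
      (deriv^[2] P t * deriv^[3] Q t - deriv^[2] Q t * deriv^[3] P t) /
      ((deriv^[1] P t * deriv^[2] Q t - deriv^[1] Q t * deriv^[2] P t) ^ 2 +
        deriv^[2] Q t ^ 2 + deriv^[2] P t ^ 2) := by
  obtain ⟨h1, h2, h3⟩ := derivs_graph hP hQ
  funext t
  have hnn : ∀ x : ℝ × ℝ × ℝ, 0 ≤ dot3 x x := fun x => by unfold dot3; nlinarith [sq_nonneg x.1]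
  simp only [tor, norm3, Real.sq_sqrt (hnn _)]
  rw [h3, h2, h1]
  simp only [dot3, cross3]
  congr 1 <;> ring

lemma tor_congr {L M : ℝ → ℝ × ℝ × ℝ} (h : L =ᶠ[𝓝 0] M) : tor L =ᶠ[𝓝 0] tor M := by
  filter_upwards [h.deriv, h.deriv.deriv, h.deriv.deriv.deriv] with t h1 h2 h3
  rw [tor, tor, h1, h2, h3]

/-- The torsion at a point where the numerator and denominator of `tor_graph` are controlled, in
terms of the function `H = x P + y Q`, with `(x, y)` proportional to `(-Q'', P'')`. -/
lemma tor_graph_zero_iff {P Q : ℝ → ℝ} (hP : ContDiff ℝ (⊤ : ℕ∞) P) (hQ : ContDiff ℝ (⊤ : ℕ∞) Q)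
    (hQ2 : deriv^[2] Q 0 ≠ 0) {c : ℝ} (hc : c ≠ 0) :
    let H := fun t => c * -deriv^[2] Q 0 * P t + c * deriv^[2] P 0 * Q t
    (tor (fun t => (t, P t, Q t)) 0 = 0 ↔ deriv^[3] H 0 = 0) ∧
    (deriv^[3] H 0 = 0 → (deriv (tor fun t => (t, P t, Q t)) 0 = 0 ↔ deriv^[4] H 0 = 0)) := by
  intro H
  rw [tor_graph hP hQ, iterate_deriv_linear_combination hP hQ,
    iterate_deriv_linear_combination hP hQ]
  have hP' := fun k => hasDerivAt_iterate_deriv hP k 0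
  have hQ' := fun k => hasDerivAt_iterate_deriv hQ k 0
  have hD : (deriv^[1] P 0 * deriv^[2] Q 0 - deriv^[1] Q 0 * deriv^[2] P 0) ^ 2 +
      deriv^[2] Q 0 ^ 2 + deriv^[2] P 0 ^ 2 ≠ 0 := by
    have := sq_pos_of_ne_zero hQ2
    positivity
  have h3 : c * -deriv^[2] Q 0 * deriv^[3] P 0 + c * deriv^[2] P 0 * deriv^[3] Q 0 =
      c * (deriv^[2] P 0 * deriv^[3] Q 0 - deriv^[2] Q 0 * deriv^[3] P 0) := by ring
  simp only [h3, mul_eq_zero, hc, false_or, div_eq_zero_iff, hD, or_false, true_and]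
  intro hN
  have hN' := ((hP' 2).mul (hQ' 3)).sub ((hQ' 2).mul (hP' 3))
  have hD' := (((((hP' 1).mul (hQ' 2)).sub ((hQ' 1).mul (hP' 2))).pow 2).add
    ((hQ' 2).pow 2)).add ((hP' 2).pow 2)
  have hτ := (hN'.div hD' hD).deriv
  have hval : deriv (fun t => (deriv^[2] P t * deriv^[3] Q t - deriv^[2] Q t * deriv^[3] P t) /
      ((deriv^[1] P t * deriv^[2] Q t - deriv^[1] Q t * deriv^[2] P t) ^ 2 +
        deriv^[2] Q t ^ 2 + deriv^[2] P t ^ 2)) 0 = _ := hτ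
  simp only [Pi.sub_apply, Pi.mul_apply, Pi.add_apply, Pi.pow_apply, hN, zero_mul, sub_zero,
    Nat.reduceAdd] at hval
  rw [hval, div_eq_zero_iff, or_iff_left (pow_ne_zero 2 hD), mul_eq_zero, or_iff_left hD]
  have h4 : c * -deriv^[2] Q 0 * deriv^[4] P 0 + c * deriv^[2] P 0 * deriv^[4] Q 0 =
      c * (deriv^[2] P 0 * deriv^[4] Q 0 - deriv^[2] Q 0 * deriv^[4] P 0) := by ring
  rw [h4, mul_eq_zero, or_iff_right hc]
  ring_nf

end Torsion

/-- for a branch `L(t) = g(t, φ(t))` of the parabolic set through the singularity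
and `ν = ±b(0)` the binormal direction, `h_ν` has an `A₂` singularity iff `τ(0) ≠ 0`, and an
`A₃` singularity iff `τ(0) = 0` and `τ'(0) ≠ 0`. -/
theorem height_along_binormal_iff_torsion (p q : ℝ → ℝ → ℝ) (b : ℕ → ℝ) (a : ℕ → ℕ → ℝ)
    (n : ℕ) (hn : 1 ≤ n) (hNF : NormalFormN (2 * n + 2) p q b a)
    (hvan : ∀ i, 2 ≤ i → i ≤ n → a i 1 = 0) (hnz : a (n + 1) 1 ≠ 0) (ha20 : a 2 0 ≠ 0)
    (ε : ℝ) (hε : 0 < ε) (φ : ℝ → ℝ) (hφ : ContDiffOn ℝ (⊤ : ℕ∞) φ (Set.Ioo (-ε) ε))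
    (hφ0 : φ 0 = 0) (hφj : ∀ j, 1 ≤ j → j ≤ n → iteratedDeriv j φ 0 = 0)
    (hSig : ∀ t : ℝ, |t| < ε → SigmaFun p q t (φ t) = 0)
    (σ : ℝ) (hσ : σ = 1 ∨ σ = -1) :
    let L : ℝ → ℝ × ℝ × ℝ := fun t => gmap p q t (φ t)
    let ν : ℝ × ℝ × ℝ :=
      σ • ((Real.sqrt (a 2 0 ^ 2 + b 2 ^ 2))⁻¹ • (((0 : ℝ), -(a 2 0), b 2) : ℝ × ℝ × ℝ))
    cross3 (deriv L 0) (deriv (deriv L) 0) = (((0 : ℝ), -(a 2 0), b 2) : ℝ × ℝ × ℝ) ∧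
    cross3 (deriv L 0) (deriv (deriv L) 0) ≠ 0 ∧
    (HasAkSingAt (hgt p q ν) 2 ↔ tor L 0 ≠ 0) ∧
    (HasAkSingAt (hgt p q ν) 3 ↔ (tor L 0 = 0 ∧ deriv (tor L) 0 ≠ 0)) := by
  obtain ⟨hp, hq, hp00, hq00, hp10, hp01, hq10, hq01, hp02, hpb, hpz, hqa, ha11, ha02⟩ := hNF
  change Smooth₂ p at hp
  change Smooth₂ q at hq
  have hid : ContDiff ℝ (⊤ : ℕ∞) (id : ℝ → ℝ) := contDiff_id
  have hp20 : pd 2 0 p 0 0 = b 2 := hpb 2 le_rfl (by omega)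
  have hq20 : pd 2 0 q 0 0 = a 2 0 := hqa 2 0 (by omega) (by omega)
  have hp11 : pd 1 1 p 0 0 = 0 := hpz 1 1 (by omega) (by omega) (by omega) (by omega)
  have hq11 : pd 1 1 q 0 0 = 0 := (hqa 1 1 (by omega) (by omega)).trans ha11
  have hq02 : pd 0 2 q 0 0 = 0 := (hqa 0 2 (by omega) (by omega)).trans ha02
  have hp21 : pd 2 1 p 0 0 = 0 := hpz 2 1 (by omega) (by omega) (by omega) (by omega)
  have hq21 : pd 2 1 q 0 0 = a 2 1 := hqa 2 1 (by omega) (by omega)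
  -- the germ of the branch extends to a global smooth function
  have hmem : (0 : ℝ) ∈ Ioo (-ε) ε := ⟨neg_lt_zero.2 hε, hε⟩
  obtain ⟨ψ, hψ, hψφ⟩ := exists_contDiff_eventuallyEq isOpen_Ioo hmem hφ
  have hψ0 : ψ 0 = 0 := hψφ.eq_of_nhds.trans hφ0
  have hψj : ∀ j, 1 ≤ j → j ≤ n → deriv^[j] ψ 0 = 0 := fun j h1 h2 => by
    rw [(iterate_deriv_congr hψφ j).eq_of_nhds, ← iteratedDeriv_eq_iterate, hφj j h1 h2]
  have hψ1 := hψj 1 le_rfl hn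
  have hS : ∀ᶠ t in 𝓝 0, SigmaFun p q t (ψ t) = 0 := by
    filter_upwards [hψφ, isOpen_Ioo.mem_nhds hmem] with t ht htε
    rw [ht, hSig t (abs_lt.2 htε)]
  have hψ2 : b 2 * pd 2 1 q 0 0 = a 2 0 * deriv^[2] ψ 0 := by
    rcases hn.eq_or_lt with rfl | hn2
    · rw [← hp20, ← hq20]
      exact deriv_two_of_sigmaFun_eq_zero hp hq hψ hψ0 hψ1 hS hp01 hq01 hp11 hq11 hp02 hq02 hp21
        (hq21 ▸ hnz)
    · rw [hq21, hvan 2 le_rfl hn2, hψj 2 one_le_two hn2, mul_zero, mul_zero]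
  -- the curve
  set P : ℝ → ℝ := fun t => p t (ψ t)
  set Q : ℝ → ℝ := fun t => q t (ψ t)
  have hP : ContDiff ℝ (⊤ : ℕ∞) P := hp.comp hid hψ
  have hQ : ContDiff ℝ (⊤ : ℕ∞) Q := hq.comp hid hψ
  have hP1 : deriv^[1] P 0 = 0 := deriv_comp_curve_of_crit hp hid hψ rfl hψ0 hp10 hp01
  have hQ1 : deriv^[1] Q 0 = 0 := deriv_comp_curve_of_crit hq hid hψ rfl hψ0 hq10 hq01
  have hP2 : deriv^[2] P 0 = b 2 :=
    (deriv_two_comp_curve_of_crit hp hid hψ rfl hψ0 hp10 hp01 hp11).trans (by simp_all)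
  have hQ2 : deriv^[2] Q 0 = a 2 0 :=
    (deriv_two_comp_curve_of_crit hq hid hψ rfl hψ0 hq10 hq01 hq11).trans (by simp_all)
  intro L ν
  have hL : L =ᶠ[𝓝 0] fun t => (t, P t, Q t) := by
    filter_upwards [hψφ] with t ht
    simp only [L, P, Q, gmap, ht]
  have hcross : cross3 (deriv L 0) (deriv (deriv L) 0) = (0, -a 2 0, b 2) := by
    obtain ⟨h1, h2, -⟩ := derivs_graph hP hQ
    rw [hL.deriv.deriv.eq_of_nhds, hL.deriv.eq_of_nhds, h2, h1]
    simp only [cross3, hP1, hQ1, hP2, hQ2]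
    ring_nf
  -- the height function
  set c : ℝ := σ * (√(a 2 0 ^ 2 + b 2 ^ 2))⁻¹
  have hc : c ≠ 0 := by
    have : 0 < a 2 0 ^ 2 + b 2 ^ 2 := by have := sq_pos_of_ne_zero ha20; positivity
    exact mul_ne_zero (by rcases hσ with rfl | rfl <;> norm_num)
      (inv_ne_zero (Real.sqrt_pos.2 this).ne')
  set h := hgt p q ν with hh_def
  have hh_eq : h = fun u w => c * -a 2 0 * p u w + c * b 2 * q u w := by
    funext u w
    simp only [hh_def, hgt, dot3, gmap, ν, c, Prod.smul_mk, smul_eq_mul]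
    ring
  have hpd : ∀ i j, pd i j h 0 0 = c * -a 2 0 * pd i j p 0 0 + c * b 2 * pd i j q 0 0 :=
    fun i j => by rw [hh_eq, pd_linear_combination hp hq]
  have hh : Smooth₂ h := by
    rw [hh_eq]
    exact (contDiff_const.mul hp).add (contDiff_const.mul hq)
  have h00 : h 0 0 = 0 := by simp [hh_eq, hp00, hq00]
  have h10 : pd 1 0 h 0 0 = 0 := by simp [hpd, hp10, hq10]
  have h01 : pd 0 1 h 0 0 = 0 := by simp [hpd, hp01, hq01]
  have h20 : pd 2 0 h 0 0 = 0 := by rw [hpd, hp20, hq20]; ring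
  have h11 : pd 1 1 h 0 0 = 0 := by simp [hpd, hp11, hq11]
  have h02 : pd 0 2 h 0 0 ≠ 0 := by simp [hpd, hp02, hq02, hc, ha20]
  have h21 : pd 2 1 h 0 0 + pd 0 2 h 0 0 * deriv^[2] ψ 0 = 0 := by
    rw [hpd, hpd, hp21, hp02, hq02]
    linear_combination c * hψ2
  -- the torsion in terms of the height along the curve
  have hτ := tor_graph_zero_iff hP hQ (hQ2 ▸ ha20) hc
  dsimp only at hτ
  rw [hP2, hQ2, show (fun t => c * -a 2 0 * P t + c * b 2 * Q t) = fun t => h (id t) (ψ t) by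
    rw [hh_eq]; rfl, deriv_three_comp_curve_of_crit hh hid hψ rfl hψ0 hψ1 h10 h01 h20 h11,
    Function.iterate_one, deriv_id, one_pow, mul_one, ← (tor_congr hL).eq_of_nhds,
    ← (tor_congr hL).deriv_eq] at hτ
  refine ⟨hcross, ?_, ?_, ?_⟩
  · rw [hcross]
    simp [ha20]
  · rw [hasAkSingAt_two_iff hh h00 h10 h01 h20 h11 h02, ne_eq, ne_eq, hτ.1]
  · rw [hasAkSingAt_three_iff hh h00 h10 h01 h20 h11 h02, hτ.1]
    refine and_congr_right fun h30 => not_congr ?_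
    have h4 := deriv_four_comp_curve_of_crit hh hid hψ rfl hψ0 hψ1 h10 h01 h20 h11 h30
      (by simpa using h21)
    rw [Function.iterate_one, deriv_id, one_pow, mul_one] at h4
    rw [hτ.2 h30, ← h4, mul_eq_zero, or_iff_left h02]
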